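/- arXiv:1511.00192 — 5 statements merged into one kernel-verified Lean document; each statement's English description precedes it below -/
import Mathlib

section
/- Let k ≥ 3 and let 2 ≤ a ≤ k−1. Then for every n > k, |Π_n(β_{k,a+1})| ≤ |Π_n(β_{k,a})|, where β_{k,a} is the set partition of [k] whose blocks are {a} and [k]∖{a}. -/
open Finset

/-- The ground set `[n] = {1, …, n}`. -/
def Idx (n : ℕ) : Finset ℕ := Finset.Icc 1 n

/-- `i` and `j` lie in the same block of the set partition `π`. -/
def SameBlock {n : ℕ} (π : Finpartition (Idx n)) (i j : ℕ) : Prop :=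
  ∃ B ∈ π.parts, i ∈ B ∧ j ∈ B

/-- Klazar containment: `σ ⊢ [n]` contains `τ ⊢ [k]` if there is a strictly increasing
map `f : [k] → [n]` such that `i, j` are in the same block of `τ` iff `f i, f j` are in
the same block of `σ`. -/
def Contains {k n : ℕ} (τ : Finpartition (Idx k)) (σ : Finpartition (Idx n)) : Prop :=
  ∃ f : ℕ → ℕ, StrictMonoOn f (Idx k) ∧ (∀ i ∈ Idx k, f i ∈ Idx n) ∧
    ∀ i ∈ Idx k, ∀ j ∈ Idx k, (SameBlock τ i j ↔ SameBlock σ (f i) (f j))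

/-- `σ` avoids the pattern `τ`. -/
def Avoids {k n : ℕ} (σ : Finpartition (Idx n)) (τ : Finpartition (Idx k)) : Prop :=
  ¬ Contains τ σ

/-- `|Π_n(τ)|`, the number of set partitions of `[n]` avoiding `τ`. -/
noncomputable def avoidCount (n : ℕ) {k : ℕ} (τ : Finpartition (Idx k)) : ℕ :=
  Nat.card {σ : Finpartition (Idx n) // Avoids σ τ}

section Words

variable {α : Type*} [DecidableEq α]

/-- Increment the value of the counter `f` at the letter `x`. -/
def bump (f : α → ℕ) (x : α) : α → ℕ := Function.update f x (f x + 1)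

/-- Reading `w` with `f b` copies of each letter `b` already seen, no letter `x ≠ b` occurs
while the number of copies of `b` seen lies in `[p, p + M b)`. -/
def GapFree (p : ℕ) (M : α → ℕ) : (α → ℕ) → List α → Prop
  | _, [] => True
  | f, x :: w => (∀ b, b ≠ x → ¬(p ≤ f b ∧ f b < p + M b)) ∧ GapFree p M (bump f x) w

/-- For every letter `b`, move the occurrences of `b` with (zero-based) index in `[p, p + M b)`
immediately after the occurrence of index `p - 1`. -/
def gather (p : ℕ) (M : α → ℕ) : (α → ℕ) → List α → List α
  | _, [] => []
  | f, x :: w =>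
    if p ≤ f x ∧ f x < p + M x then gather p M (bump f x) w
    else x :: ((if f x + 1 = p then List.replicate (M x) x else []) ++ gather p M (bump f x) w)

/-- The number of copies of a letter output by `gather` after reading `j` copies of it,
when `m` copies are moved. -/
def gatherCount (p m j : ℕ) : ℕ := if p ≤ j ∧ j < p + m then p + m else j

/-- The excess of the number of occurrences of each letter over `k - 2`. -/
def excess (k : ℕ) (w : List α) (b : α) : ℕ := w.count b - (k - 2)

theorem gapFree_iff (p : ℕ) (M f : α → ℕ) (w : List α) :
    GapFree p M f w ↔ ∀ u x v, w = u ++ x :: v → ∀ b, b ≠ x →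
      ¬(p ≤ f b + u.count b ∧ f b + u.count b < p + M b) := by
  induction w generalizing f with
  | nil => simp [GapFree]
  | cons y w ih =>
    rw [GapFree, ih]
    have hb : ∀ (u : List α) b, bump f y b + u.count b = f b + (y :: u).count b := by
      intro u b
      by_cases h : b = y
      · subst h; simp [bump]; omega
      · simp [bump, h, Ne.symm h]
    constructor
    · rintro ⟨h1, h2⟩ u x v h b hbx
      cases u with
      | nil =>
        simp only [List.nil_append, List.cons.injEq] at h
        obtain ⟨rfl, rfl⟩ := h
        simpa using h1 b hbx
      | cons z u =>
        simp only [List.cons_append, List.cons.injEq] at h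
        obtain ⟨rfl, rfl⟩ := h
        rw [← hb]
        exact h2 u x v rfl b hbx
    · intro h
      refine ⟨fun b hby => by simpa using h [] y w rfl b hby, fun u x v hw b hbx => ?_⟩
      rw [hb]
      exact h (y :: u) x v (by simp [hw]) b hbx

theorem GapFree.replicate_append {p : ℕ} {M f : α → ℕ} {x : α} {w : List α} {m : ℕ}
    (hf : ∀ b, b ≠ x → ¬(p ≤ f b ∧ f b < p + M b))
    (hw : GapFree p M (Function.update f x (f x + m)) w) :
    GapFree p M f (List.replicate m x ++ w) := by
  induction m generalizing f with
  | zero => simpa using hw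
  | succ m ih =>
    refine ⟨hf, ih (fun b hb => by simpa [bump, hb] using hf b hb) ?_⟩
    convert hw using 1
    ext b
    by_cases h : b = x
    · subst h; simp [bump]; omega
    · simp [bump, h]

theorem gapFree_gather (p : ℕ) (M f : α → ℕ) (w : List α) :
    GapFree p M (fun b => gatherCount p (M b) (f b)) (gather p M f w) := by
  induction w generalizing f with
  | nil => trivial
  | cons x w ih =>
    have key : ∀ b, ¬(p ≤ gatherCount p (M b) (f b) ∧ gatherCount p (M b) (f b) < p + M b) := by
      intro b; unfold gatherCount; split_ifs <;> omega
    rw [gather]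
    split_ifs with h1 h2
    · convert ih (bump f x) using 1
      ext b
      by_cases h : b = x
      · subst h; simp only [bump, Function.update_self, gatherCount]; split_ifs <;> omega
      · simp [bump, h]
    · refine ⟨fun b _ => key b, ?_⟩
      refine GapFree.replicate_append (fun b hb => by simpa [bump, hb] using key b) ?_
      convert ih (bump f x) using 1
      ext b
      by_cases h : b = x
      · subst h; simp only [bump, Function.update_self, gatherCount]; split_ifs <;> omega
      · simp [bump, h]
    · refine ⟨fun b _ => key b, ?_⟩
      rw [List.nil_append]
      convert ih (bump f x) using 1
      ext b
      by_cases h : b = x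
      · subst h; simp only [bump, Function.update_self, gatherCount]; split_ifs <;> omega
      · simp [bump, h]

theorem count_gather (p : ℕ) (M f : α → ℕ) (w : List α) (b : α) :
    (gather p M f w).count b + gatherCount p (M b) (f b) =
      gatherCount p (M b) (f b + w.count b) := by
  induction w generalizing f with
  | nil => simp [gather]
  | cons x w ih =>
    have := ih (bump f x)
    rw [gather]
    by_cases h : b = x
    · subst h
      have e : bump f b b + w.count b = f b + (b :: w).count b := by
        simp [bump]; omega
      rw [e] at this
      rw [← this]
      simp only [bump, Function.update_self, gatherCount]
      split_ifs <;> simp <;> omega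
    · have e : bump f x b = f b := by simp [bump, h]
      rw [e] at this
      rw [List.count_cons_of_ne (Ne.symm h), ← this]
      split_ifs <;> simp [List.count_replicate, Ne.symm h]

theorem gather_perm {k p : ℕ} (hp : 1 ≤ p) (hpk : p ≤ k - 2) (w : List α) :
    (gather p (excess k w) (fun _ => 0) w).Perm w := by
  rw [List.perm_iff_count]
  intro b
  have := count_gather p (excess k w) (fun _ => 0) w b
  have hb : excess k w b = w.count b - (k - 2) := rfl
  rw [gatherCount, gatherCount, if_neg (by omega), if_neg (by omega)] at this
  omega

theorem gather_head {p : ℕ} {M f : α → ℕ} {w : List α} {x : α} (hw : GapFree (p + 1) M f w)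
    (h1 : p + 1 ≤ f x) (h2 : f x ≤ p + M x) :
    (gather p M f w = [] ∧ ∀ z ∈ w, z = x) ∨ ∃ t, gather p M f w = x :: t := by
  induction w generalizing f with
  | nil => simp [gather]
  | cons y w ih =>
    obtain rfl : x = y := by
      by_contra hxy
      exact hw.1 x hxy ⟨h1, by omega⟩
    rw [gather]
    split_ifs with h
    · rcases ih hw.2 (by simp [bump]; omega) (by simp [bump]; omega) with h | h
      · left; simpa using h
      · right; exact h
    all_goals exact .inr ⟨_, rfl⟩

theorem gather_injective {p : ℕ} {M f : α → ℕ} {w w' : List α} (hw : GapFree (p + 1) M f w)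
    (hw' : GapFree (p + 1) M f w') (hperm : w.Perm w') (h : gather p M f w = gather p M f w') :
    w = w' := by
  induction w generalizing f w' with
  | nil => exact hperm.nil_eq
  | cons x w ih =>
    cases w' with
    | nil => simpa using hperm.length_eq
    | cons y w' =>
      by_cases hxy : x = y
      · subst hxy
        congr 1
        refine ih hw.2 hw'.2 hperm.cons_inv ?_
        simp only [gather] at h
        split_ifs at h <;> simpa using h
      · exfalso
        have head : ∀ {a c : α} {v v' : List α}, c ≠ a → GapFree (p + 1) M f (a :: v) →
            GapFree (p + 1) M f (c :: v') →
            (gather p M f (a :: v) = [] ∧ ∀ z ∈ a :: v, z = a) ∨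
              ∃ t, gather p M f (a :: v) = a :: t := by
          intro a c v v' hca hv hv'
          rw [gather]
          split_ifs with hd
          · have := hv'.1 a (Ne.symm hca)
            have hfa : f a = p := by omega
            rcases gather_head (x := a) hv.2 (by simp [bump]; omega) (by simp [bump]; omega)
              with h | h
            · left; simpa using h
            · right; exact h
          all_goals exact .inr ⟨_, rfl⟩
        have hy := hperm.mem_iff.2 (List.mem_cons_self (a := y) (l := w'))
        rcases head (Ne.symm hxy) hw hw' with ⟨e1, z1⟩ | ⟨t, e1⟩
        · exact hxy (z1 y hy).symm
        · rcases head hxy hw' hw with ⟨e2, z2⟩ | ⟨t', e2⟩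
          · exact hxy (z2 x (hperm.mem_iff.1 List.mem_cons_self))
          · rw [e1, e2] at h
            exact hxy (List.cons.inj h).1

theorem map_gather {β : Type*} [DecidableEq β] {p : ℕ} {M f : α → ℕ} {M' f' : β → ℕ} {g : α → β}
    {w : List α} (hg : Set.InjOn g {b | b ∈ w}) (hM : ∀ b ∈ w, M' (g b) = M b)
    (hf : ∀ b ∈ w, f' (g b) = f b) :
    (gather p M f w).map g = gather p M' f' (w.map g) := by
  induction w generalizing f f' with
  | nil => rfl
  | cons x w ih =>
    have hM0 := hM x List.mem_cons_self
    have hf0 := hf x List.mem_cons_self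
    have := ih (f := bump f x) (f' := bump f' (g x))
      (hg.mono fun b hb => List.mem_cons_of_mem _ hb)
      (fun b hb => hM b (List.mem_cons_of_mem _ hb)) (by
        intro b hb
        by_cases hbx : b = x
        · subst hbx; simp [bump, hf0]
        · have : g b ≠ g x := fun e =>
            hbx (hg (List.mem_cons_of_mem _ hb) List.mem_cons_self e)
          simp [bump, hbx, this, hf b (List.mem_cons_of_mem _ hb)])
    rw [List.map_cons, gather, gather, hM0, hf0, ← this]
    split_ifs <;> simp

theorem count_map_of_injOn {β : Type*} [DecidableEq β] {g : α → β} {w : List α}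
    (hg : Set.InjOn g {b | b ∈ w}) {b : α} (hb : b ∈ w) :
    (w.map g).count (g b) = w.count b := by
  simp only [List.count, List.countP_map]
  refine List.countP_congr fun x hx => ?_
  simpa using ⟨fun e => hg hx hb e, fun e => congrArg g e⟩

theorem not_gapFree_excess_iff {k c : ℕ} (hk : 3 ≤ k) (hc : 2 ≤ c) (hck : c ≤ k) (w : List α) :
    ¬ GapFree (c - 1) (excess k w) (fun _ => 0) w ↔ ∃ b x, b ≠ x ∧
      (List.replicate (c - 1) b ++ x :: List.replicate (k - c) b).Sublist w := by
  rw [gapFree_iff]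
  push Not
  constructor
  · rintro ⟨u, x, v, rfl, b, hbx, h1, h2⟩
    refine ⟨b, x, hbx, List.Sublist.append ?_ (List.Sublist.cons_cons x ?_)⟩
    · rw [List.replicate_sublist_iff]; omega
    · rw [List.replicate_sublist_iff]
      simp [excess, List.count_append, List.count_cons_of_ne (Ne.symm hbx)] at h2
      omega
  · rintro ⟨b, x, hbx, h⟩
    obtain ⟨r, r', rfl, h1, h2⟩ := List.append_sublist_iff.1 h
    obtain ⟨s, t, rfl, h3, h4⟩ := List.cons_sublist_iff.1 h2
    obtain ⟨s1, s2, rfl⟩ := List.append_of_mem h3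
    refine ⟨r ++ s1, x, s2 ++ t, by simp, b, hbx, ?_⟩
    rw [List.replicate_sublist_iff] at h1 h4
    simp [excess, List.count_append, List.count_cons_of_ne (Ne.symm hbx)]
    omega

end Words

section Partitions

variable {α : Type*} {n k : ℕ}

/-- The blocks of `σ` are the sets of positions of equal letters of the word `w`. -/
def Represents (σ : Finpartition (Idx n)) (w : List α) : Prop :=
  w.length = n ∧ ∀ i < n, ∀ j < n, SameBlock σ (i + 1) (j + 1) ↔ w[i]? = w[j]?

theorem mem_Idx {i : ℕ} : i ∈ Idx n ↔ 1 ≤ i ∧ i ≤ n := Finset.mem_Icc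

theorem mem_part_iff_sameBlock {σ : Finpartition (Idx n)} {i j : ℕ} :
    i ∈ σ.part j ↔ SameBlock σ i j := σ.mem_part_iff_exists

/-- The word listing the block of each element of `[n]`. -/
def blockWord (σ : Finpartition (Idx n)) : List (Finset ℕ) :=
  (List.range n).map fun i => σ.part (i + 1)

theorem represents_blockWord (σ : Finpartition (Idx n)) : Represents σ (blockWord σ) := by
  refine ⟨by simp [blockWord], fun i hi j hj => ?_⟩
  rw [← mem_part_iff_sameBlock, σ.mem_part_iff_part_eq_part (mem_Idx.2 (by omega))
    (mem_Idx.2 (by omega))]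
  simp [blockWord, hi, hj]

open Classical in
/-- The set partition of `[n]` into the sets of positions of equal letters of `w`. -/
noncomputable def wordPartition (n : ℕ) (w : List α) : Finpartition (Idx n) :=
  Finpartition.ofSetSetoid (Setoid.ker fun i => w[i - 1]?) (Idx n)

theorem represents_wordPartition {w : List α} (hw : w.length = n) :
    Represents (wordPartition n w) w := by
  classical
  refine ⟨hw, fun i hi j hj => ?_⟩
  rw [← mem_part_iff_sameBlock, wordPartition, Finpartition.mem_part_ofSetSetoid_iff_rel,
    mem_Idx, mem_Idx, Setoid.ker_def]
  simp only [Nat.add_sub_cancel]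
  constructor
  · exact fun h => h.2.2.symm
  · exact fun h => ⟨by omega, by omega, h.symm⟩

theorem Represents.eq {σ τ : Finpartition (Idx n)} {w : List α} (hσ : Represents σ w)
    (hτ : Represents τ w) : σ = τ := by
  have aux : ∀ {σ τ : Finpartition (Idx n)}, Represents σ w → Represents τ w →
      ∀ {i j}, SameBlock σ i j → SameBlock τ i j := by
    rintro σ τ hσ hτ i j h
    obtain ⟨B, hB, hi, hj⟩ := id h
    have hi' := mem_Idx.1 (σ.le hB hi)
    have hj' := mem_Idx.1 (σ.le hB hj)
    obtain ⟨i, rfl⟩ := Nat.exists_eq_add_of_le' hi'.1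
    obtain ⟨j, rfl⟩ := Nat.exists_eq_add_of_le' hj'.1
    exact (hτ.2 i (by omega) j (by omega)).2 ((hσ.2 i (by omega) j (by omega)).1 h)
  have hpart : σ.part = τ.part := by
    ext j i
    rw [mem_part_iff_sameBlock, mem_part_iff_sameBlock]
    exact ⟨aux hσ hτ, aux hτ hσ⟩
  ext B
  have parts_iff : ∀ π : Finpartition (Idx n), B ∈ π.parts ↔ ∃ i ∈ Idx n, π.part i = B := by
    intro π
    constructor
    · intro hB
      obtain ⟨i, hi, h⟩ := π.part_surjOn hB
      exact ⟨i, hi, h⟩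
    · rintro ⟨i, hi, rfl⟩
      exact π.part_mem.2 hi
  rw [parts_iff, parts_iff, hpart]

theorem Represents.map {β : Type*} {σ : Finpartition (Idx n)} {w : List α} {g : α → β}
    (h : Represents σ w) (hg : Set.InjOn g {b | b ∈ w}) : Represents σ (w.map g) := by
  obtain ⟨rfl, h⟩ := h
  refine ⟨by simp, fun i hi j hj => ?_⟩
  rw [h i hi j hj]
  simp only [List.getElem?_map, List.getElem?_eq_getElem hi, List.getElem?_eq_getElem hj,
    Option.map_some, Option.some.injEq]
  exact ⟨fun e => congrArg g e, fun e => hg (List.getElem_mem hi) (List.getElem_mem hj) e⟩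

theorem Represents.exists_map [DecidableEq α] {σ : Finpartition (Idx n)} {v v' : List α}
    (h : Represents σ v) (h' : Represents σ v') :
    ∃ g : α → α, v.map g = v' ∧ Set.InjOn g {b | b ∈ v} := by
  obtain ⟨hl, h⟩ := h
  obtain ⟨hl', h'⟩ := h'
  have hidx : ∀ b ∈ v, v.idxOf b < n := fun b hb => hl ▸ List.idxOf_lt_length_of_mem hb
  have hget : ∀ b ∈ v, v[v.idxOf b]? = some b := fun b hb => by
    rw [List.getElem?_eq_getElem (List.idxOf_lt_length_of_mem hb)]; simp
  have hget' : ∀ b ∈ v, v'[v.idxOf b]? = some (v'[v.idxOf b]?.getD b) := fun b hb => by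
    rw [List.getElem?_eq_getElem (hl' ▸ hidx b hb)]; simp
  refine ⟨fun b => v'[v.idxOf b]?.getD b, ?_, ?_⟩
  · refine List.ext_getElem? fun i => ?_
    by_cases hi : i < n
    · have hb : v[i] ∈ v := List.getElem_mem _
      rw [List.getElem?_map, List.getElem?_eq_getElem (by omega), Option.map_some, ← hget' _ hb,
        ← h' _ (hidx _ hb) _ hi, h _ (hidx _ hb) _ hi, hget _ hb, List.getElem?_eq_getElem]
    · rw [List.getElem?_eq_none (by simp; omega), List.getElem?_eq_none (by omega)]
  · intro b hb c hc hbc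
    have : v'[v.idxOf b]? = v'[v.idxOf c]? := by
      rw [hget' b hb, hget' c hc]; exact congrArg some hbc
    rw [← h' _ (hidx b hb) _ (hidx c hc), h _ (hidx b hb) _ (hidx c hc), hget b hb,
      hget c hc] at this
    exact Option.some.inj this

theorem sameBlock_beta_iff {c : ℕ} {β : Finpartition (Idx k)} (hβ : β.parts = {{c}, Idx k \ {c}})
    {i j : ℕ} (hi : i ∈ Idx k) (hj : j ∈ Idx k) : SameBlock β i j ↔ (i = c ↔ j = c) := by
  simp only [SameBlock, hβ, mem_insert, mem_singleton, exists_eq_or_imp, exists_eq_left,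
    mem_sdiff, hi, hj, true_and]
  tauto

theorem getElem?_pattern {c i : ℕ} (hc : 1 ≤ c) (hck : c ≤ k) (hi : i < k) (b x : α) :
    (List.replicate (c - 1) b ++ x :: List.replicate (k - c) b)[i]? =
      some (if i + 1 = c then x else b) := by
  rw [List.getElem?_append, List.length_replicate]
  split_ifs with h1 h2 h2
  · omega
  · rw [List.getElem?_replicate_of_lt h1]
  · simp [← h2]
  · obtain ⟨m, hm⟩ : ∃ m, i - (c - 1) = m + 1 := ⟨i - c, by omega⟩
    rw [hm, List.getElem?_cons_succ, List.getElem?_replicate_of_lt (by omega)]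

theorem contains_beta_iff [DecidableEq α] {c : ℕ} (hk : 3 ≤ k) (hc : 2 ≤ c) (hck : c ≤ k)
    {β : Finpartition (Idx k)} (hβ : β.parts = {{c}, Idx k \ {c}}) {σ : Finpartition (Idx n)}
    {w : List α} (hw : Represents σ w) :
    Contains β σ ↔ ∃ b x, b ≠ x ∧
      (List.replicate (c - 1) b ++ x :: List.replicate (k - c) b).Sublist w := by
  obtain ⟨rfl, hw⟩ := hw
  constructor
  · rintro ⟨f, hmono, hmem, hf⟩
    have hlt : ∀ i ∈ Idx k, f i - 1 < w.length := fun i hi => by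
      have := mem_Idx.1 (hmem i hi); omega
    have hsame : ∀ i ∈ Idx k, ∀ j ∈ Idx k, (w[f i - 1]? = w[f j - 1]? ↔ (i = c ↔ j = c)) := by
      intro i hi j hj
      rw [← hw _ (hlt i hi) _ (hlt j hj), Nat.sub_add_cancel (mem_Idx.1 (hmem i hi)).1,
        Nat.sub_add_cancel (mem_Idx.1 (hmem j hj)).1, ← hf i hi j hj, sameBlock_beta_iff hβ hi hj]
    have h1 : 1 ∈ Idx k := mem_Idx.2 (by omega)
    have hcm : c ∈ Idx k := mem_Idx.2 (by omega)
    refine ⟨w[f 1 - 1]'(hlt 1 h1), w[f c - 1]'(hlt c hcm), fun e => ?_, ?_⟩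
    · have := (hsame 1 h1 c hcm).1 (by
        rw [List.getElem?_eq_getElem (hlt 1 h1), List.getElem?_eq_getElem (hlt c hcm), e])
      omega
    · rw [List.sublist_iff_exists_fin_orderEmbedding_get_eq]
      have hlen : (List.replicate (c - 1) (w[f 1 - 1]'(hlt 1 h1)) ++
          w[f c - 1]'(hlt c hcm) :: List.replicate (k - c) (w[f 1 - 1]'(hlt 1 h1))).length = k := by
        simp; omega
      have hm : ∀ i : Fin (List.replicate (c - 1) (w[f 1 - 1]'(hlt 1 h1)) ++
          w[f c - 1]'(hlt c hcm) :: List.replicate (k - c) (w[f 1 - 1]'(hlt 1 h1))).length,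
          (i : ℕ) + 1 ∈ Idx k := fun i => mem_Idx.2 (by have := i.2; omega)
      refine ⟨OrderEmbedding.ofStrictMono (fun i => ⟨f (i + 1) - 1, hlt _ (hm i)⟩) ?_, ?_⟩
      · intro i j hij
        have h2 := hmono (hm i) (hm j) (Nat.succ_lt_succ hij)
        have h3 := mem_Idx.1 (hmem _ (hm i))
        simp only [Fin.mk_lt_mk]
        omega
      · intro i
        rw [← Option.some_inj, List.get_eq_getElem, ← List.getElem?_eq_getElem,
          getElem?_pattern (by omega) hck (by have := i.2; omega), List.get_eq_getElem,
          ← List.getElem?_eq_getElem]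
        change _ = w[f (i + 1) - 1]?
        split_ifs with hic
        · rw [hic, List.getElem?_eq_getElem]
        · rw [← List.getElem?_eq_getElem, hsame 1 h1 _ (hm i)]
          omega
  · rintro ⟨b, x, hbx, h⟩
    obtain ⟨f, hf⟩ := List.sublist_iff_exists_orderEmbedding_getElem?_eq.1 h
    have hfk : ∀ i < k, w[f i]? = some (if i + 1 = c then x else b) := fun i hi => by
      rw [← hf, getElem?_pattern (by omega) hck hi]
    have hlt : ∀ i < k, f i < w.length := fun i hi => by
      by_contra hn
      have := hfk i hi
      rw [List.getElem?_eq_none (by omega)] at this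
      simp at this
    refine ⟨fun i => f (i - 1) + 1, ?_, ?_, ?_⟩
    · intro i hi j hj hij
      have hi := mem_Idx.1 hi
      have := f.strictMono (show i - 1 < j - 1 by omega)
      simpa using this
    · intro i hi
      have hi := mem_Idx.1 hi
      have := hlt (i - 1) (by omega)
      exact mem_Idx.2 ⟨by simp, this⟩
    · intro i hi j hj
      rw [sameBlock_beta_iff hβ hi hj]
      have hi := mem_Idx.1 hi
      have hj := mem_Idx.1 hj
      rw [hw _ (hlt (i - 1) (by omega)) _ (hlt (j - 1) (by omega)), hfk _ (by omega),
        hfk _ (by omega), Nat.sub_add_cancel hi.1, Nat.sub_add_cancel hj.1]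
      by_cases h1 : i = c <;> by_cases h2 : j = c <;> simp [h1, h2, hbx, hbx.symm]

theorem avoids_beta_iff_gapFree [DecidableEq α] {c : ℕ} (hk : 3 ≤ k) (hc : 2 ≤ c) (hck : c ≤ k)
    {β : Finpartition (Idx k)} (hβ : β.parts = {{c}, Idx k \ {c}}) {σ : Finpartition (Idx n)}
    {w : List α} (hw : Represents σ w) :
    Avoids σ β ↔ GapFree (c - 1) (excess k w) (fun _ => 0) w := by
  rw [Avoids, contains_beta_iff hk hc hck hβ hw, ← not_gapFree_excess_iff hk hc hck, not_not]

/-- The word of blocks of `σ`, with the excess copies of each block moved by `gather`. -/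
def gatherWord (k p : ℕ) (σ : Finpartition (Idx n)) : List (Finset ℕ) :=
  gather p (excess k (blockWord σ)) (fun _ => 0) (blockWord σ)

theorem gatherWord_perm {p : ℕ} (hp : 1 ≤ p) (hpk : p ≤ k - 2) (σ : Finpartition (Idx n)) :
    (gatherWord k p σ).Perm (blockWord σ) := gather_perm hp hpk _

theorem excess_congr [DecidableEq α] {v w : List α} (h : v.Perm w) : excess k v = excess k w := by
  ext b
  rw [excess, excess, h.count_eq]

theorem represents_gatherWord {p : ℕ} (hp : 1 ≤ p) (hpk : p ≤ k - 2) (σ : Finpartition (Idx n)) :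
    Represents (wordPartition n (gatherWord k p σ)) (gatherWord k p σ) :=
  represents_wordPartition ((gatherWord_perm hp hpk σ).length_eq.trans (represents_blockWord σ).1)

theorem wordPartition_gatherWord_injOn {a : ℕ} (hk : 3 ≤ k) (ha : 2 ≤ a) (hak : a ≤ k - 1)
    {β : Finpartition (Idx k)} (hβ : β.parts = {{a + 1}, Idx k \ {a + 1}})
    {σ τ : Finpartition (Idx n)} (hσ : Avoids σ β) (hτ : Avoids τ β)
    (h : wordPartition n (gatherWord k (a - 1) σ) = wordPartition n (gatherWord k (a - 1) τ)) :
    σ = τ := by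
  have hp : 1 ≤ a - 1 := by omega
  have hpk : a - 1 ≤ k - 2 := by omega
  have hpσ := gatherWord_perm hp hpk σ
  have hpτ := gatherWord_perm hp hpk τ
  obtain ⟨g, hg, hinj⟩ := (represents_gatherWord hp hpk σ).exists_map
    (h ▸ represents_gatherWord hp hpk τ)
  have hinj' : Set.InjOn g {b | b ∈ blockWord σ} := fun b hb c hc e =>
    hinj (hpσ.mem_iff.2 hb) (hpσ.mem_iff.2 hc) e
  have hrep := (represents_blockWord σ).map hinj'
  have hperm : ((blockWord σ).map g).Perm (blockWord τ) :=
    (hpσ.map g).symm.trans (hg ▸ hpτ)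
  have hex := excess_congr (k := k) hperm
  have ha1 : a + 1 - 1 = a - 1 + 1 := by omega
  have hgσ := (avoids_beta_iff_gapFree hk (by omega) (by omega) hβ hrep).1 hσ
  have hgτ := (avoids_beta_iff_gapFree hk (by omega) (by omega) hβ (represents_blockWord τ)).1 hτ
  rw [ha1, hex] at hgσ
  rw [ha1] at hgτ
  have heq : (blockWord σ).map g = blockWord τ := by
    refine gather_injective hgσ hgτ hperm ?_
    rw [← map_gather (M := excess k (blockWord σ)) (f := fun _ => 0) hinj' ?_ (fun _ _ => rfl)]
    · exact hg
    · intro b hb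
      rw [← hex, excess, excess, count_map_of_injOn hinj' hb]
  exact (heq ▸ hrep).eq (represents_blockWord τ)

theorem avoids_wordPartition_gatherWord {a : ℕ} (hk : 3 ≤ k) (ha : 2 ≤ a) (hak : a ≤ k - 1)
    {β : Finpartition (Idx k)} (hβ : β.parts = {{a}, Idx k \ {a}}) (σ : Finpartition (Idx n)) :
    Avoids (wordPartition n (gatherWord k (a - 1) σ)) β := by
  have hp : 1 ≤ a - 1 := by omega
  have hpk : a - 1 ≤ k - 2 := by omega
  rw [avoids_beta_iff_gapFree hk ha (by omega) hβ (represents_gatherWord hp hpk σ),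
    excess_congr (gatherWord_perm hp hpk σ)]
  convert gapFree_gather (a - 1) (excess k (blockWord σ)) (fun _ => 0) (blockWord σ) using 1
  swap
  · rfl
  ext b
  rw [gatherCount, if_neg (by omega)]

end Partitions

/-- For `2 ≤ a ≤ k - 1` and `n > k`, `|Π_n(β_{k,a+1})| ≤ |Π_n(β_{k,a})|`. -/
theorem avoidCount_beta_succ_le (k a : ℕ) (hk : 3 ≤ k) (ha : 2 ≤ a) (hak : a ≤ k - 1)
    (βa βa1 : Finpartition (Idx k))
    (hβa : βa.parts = {{a}, Idx k \ {a}})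
    (hβa1 : βa1.parts = {{a + 1}, Idx k \ {a + 1}}) :
    ∀ n : ℕ, k < n → avoidCount n βa1 ≤ avoidCount n βa := by
  intro n _
  refine Nat.card_le_card_of_injective
    (fun σ : {σ : Finpartition (Idx n) // Avoids σ βa1} =>
      (⟨wordPartition n (gatherWord k (a - 1) σ.1),
        avoids_wordPartition_gatherWord hk ha hak hβa σ.1⟩ :
        {σ : Finpartition (Idx n) // Avoids σ βa})) ?_
  rintro ⟨σ, hσ⟩ ⟨τ, hτ⟩ h
  exact Subtype.ext
    (wordPartition_gatherWord_injOn hk ha hak hβa1 hσ hτ (congrArg Subtype.val h))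
end

section
/- Let k ≥ 3. Then for every n ≥ 2k−2, |Π_n(β_{k,k})| < |Π_n(β_{k,k−1})|, where β_{k,a} is the set partition of [k] whose blocks are {a} and [k]∖{a}. -/
open Finset

theorem mem_idx {n i : ℕ} : i ∈ Idx n ↔ 1 ≤ i ∧ i ≤ n := Finset.mem_Icc

theorem sameBlock_iff {n : ℕ} {π : Finpartition (Idx n)} {B : Finset ℕ} (hB : B ∈ π.parts)
    {i j : ℕ} (hi : i ∈ B) : SameBlock π i j ↔ j ∈ B := by
  refine ⟨?_, fun hj ↦ ⟨B, hB, hi, hj⟩⟩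
  rintro ⟨C, hC, hiC, hjC⟩
  rwa [π.eq_of_mem_parts hB hC hi hiC]

theorem sameBlock_iff_of_parts {k a : ℕ} {β : Finpartition (Idx k)}
    (hβ : β.parts = {{a}, Idx k \ {a}}) {i j : ℕ} (hi : i ∈ Idx k) (hj : j ∈ Idx k) :
    SameBlock β i j ↔ (i = a ↔ j = a) := by
  simp only [SameBlock, hβ, mem_insert, mem_singleton, exists_eq_or_imp, exists_eq_left,
    mem_sdiff, hi, hj, true_and]
  tauto

/-- Every finite set of naturals is enumerated in increasing order by `{1, …, #S}`. -/
theorem exists_strictMonoOn_mem (S : Finset ℕ) :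
    ∃ g : ℕ → ℕ, StrictMonoOn g (Idx #S) ∧ ∀ i ∈ Idx #S, g i ∈ S := by
  induction S using Finset.induction_on_max with
  | empty => exact ⟨id, strictMono_id.strictMonoOn _, by simp [Idx]⟩
  | insert a S hS ih =>
    obtain ⟨g, hg, hgS⟩ := ih
    have ha : a ∉ S := fun h ↦ (hS a h).false
    rw [card_insert_of_notMem ha]
    refine ⟨fun i ↦ if i = #S + 1 then a else g i, ?_, ?_⟩
    · intro i hi j hj hij
      simp only [mem_coe, mem_idx] at hi hj
      have hi' : i ∈ Idx #S := mem_idx.2 (by omega)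
      dsimp only
      rw [if_neg (show i ≠ #S + 1 by omega)]
      split_ifs with h
      · exact hS _ (hgS i hi')
      · exact hg hi' (mem_idx.2 (by omega)) hij
    · intro i hi
      rw [mem_idx] at hi
      dsimp only
      split_ifs with h
      · exact mem_insert_self _ _
      · exact mem_insert_of_mem (hgS i (mem_idx.2 (by omega)))

/-- A set of naturals with at least `c` elements has a `c`-th smallest element. -/
theorem exists_card_filter_le_eq (B : Finset ℕ) {c : ℕ} (hc : 0 < c) (hcB : c ≤ #B) :
    ∃ m ∈ B, #{y ∈ B | y ≤ m} = c := by
  obtain ⟨g, hg, hgB⟩ := exists_strictMonoOn_mem B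
  have himg : (Idx #B).image g = B :=
    eq_of_subset_of_card_le (image_subset_iff.2 hgB)
      (by rw [card_image_of_injOn hg.injOn]; simp [Idx])
  have hcI : c ∈ Idx #B := mem_idx.2 ⟨hc, hcB⟩
  refine ⟨g c, hgB c hcI, ?_⟩
  have : {y ∈ B | y ≤ g c} = (Idx c).image g := by
    ext y
    simp only [mem_filter, mem_image]
    constructor
    · rintro ⟨hy, hyc⟩
      rw [← himg, mem_image] at hy
      obtain ⟨i, hi, rfl⟩ := hy
      exact ⟨i, mem_idx.2 ⟨(mem_idx.1 hi).1, (hg.le_iff_le hi hcI).1 hyc⟩, rfl⟩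
    · rintro ⟨i, hi, rfl⟩
      have hi' : i ∈ Idx #B := mem_idx.2 ⟨(mem_idx.1 hi).1, (mem_idx.1 hi).2.trans hcB⟩
      exact ⟨hgB i hi', (hg.le_iff_le hi' hcI).2 (mem_idx.1 hi).2⟩
  rw [this, card_image_of_injOn (hg.injOn.mono _)]
  · simp [Idx]
  · intro i hi
    exact mem_idx.2 ⟨(mem_idx.1 hi).1, (mem_idx.1 hi).2.trans hcB⟩

theorem lt_of_card_filter_le_lt {B : Finset ℕ} {x y : ℕ}
    (h : #{z ∈ B | z ≤ x} < #{z ∈ B | z ≤ y}) : x < y := by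
  by_contra! hyx
  exact h.not_ge (card_le_card (monotone_filter_right _ fun z _ hz ↦ le_trans hz hyx))

theorem card_filter_le_lt {B : Finset ℕ} {x y : ℕ} (hy : y ∈ B) (hxy : x < y) :
    #{z ∈ B | z ≤ x} < #{z ∈ B | z ≤ y} := by
  refine card_lt_card (Finset.ssubset_iff_subset_ne.2
    ⟨monotone_filter_right _ fun z _ hz ↦ le_trans hz hxy.le, fun h ↦ ?_⟩)
  have : y ∈ {z ∈ B | z ≤ x} := h ▸ mem_filter.2 ⟨hy, le_rfl⟩
  exact hxy.not_ge (mem_filter.1 this).2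

theorem eq_of_card_filter_le_eq {B : Finset ℕ} {x y : ℕ} (hx : x ∈ B) (hy : y ∈ B)
    (h : #{z ∈ B | z ≤ x} = #{z ∈ B | z ≤ y}) : x = y := by
  rcases lt_trichotomy x y with hxy | hxy | hxy
  · exact absurd h (card_filter_le_lt hy hxy).ne
  · exact hxy
  · exact absurd h (card_filter_le_lt hx hxy).ne'

/-- In a partition avoiding `β_{k,k}`, once a block has collected `k - 1` elements it contains
every later element. -/
theorem mem_of_avoids_beta_last {k n : ℕ} {β : Finpartition (Idx k)}
    (hβ : β.parts = {{k}, Idx k \ {k}}) {σ : Finpartition (Idx n)} (hσ : Avoids σ β)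
    {B : Finset ℕ} (hB : B ∈ σ.parts) {S : Finset ℕ} (hS : S ⊆ B) (hSk : #S = k - 1)
    {x : ℕ} (hx : x ∈ Idx n) (hSx : ∀ s ∈ S, s < x) : x ∈ B := by
  by_contra hxB
  obtain ⟨g, hg, hgS⟩ := exists_strictMonoOn_mem S
  rw [hSk] at hg hgS
  have hlt {i : ℕ} (hi : i ∈ Idx k) (hik : i ≠ k) : i ∈ Idx (k - 1) := by
    rw [mem_idx] at hi ⊢; omega
  refine hσ ⟨fun i ↦ if i = k then x else g i, ?_, ?_, ?_⟩
  · intro i hi j hj hij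
    have hik : i ≠ k := by
      have := mem_idx.1 hj
      omega
    dsimp only
    rw [if_neg hik]
    split_ifs with h
    · exact hSx _ (hgS i (hlt hi hik))
    · exact hg (hlt hi hik) (hlt hj h) hij
  · intro i hi
    dsimp only
    split_ifs with h
    · exact hx
    · exact σ.le hB (hS (hgS i (hlt hi h)))
  · intro i hi j hj
    rw [sameBlock_iff_of_parts hβ hi hj]
    dsimp only
    split_ifs with h h' h'
    · obtain ⟨C, hC, hxC⟩ := σ.exists_mem hx
      simpa [h, h'] using ⟨C, hC, hxC, hxC⟩
    · have hj' := hS (hgS j (hlt hj h'))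
      have : ¬ SameBlock σ x (g j) := fun ⟨C, hC, hxC, hjC⟩ ↦
        hxB ((sameBlock_iff hB hj').1 ⟨C, hC, hjC, hxC⟩)
      simp [h, h', this]
    · simp [h, h', sameBlock_iff hB (hS (hgS i (hlt hi h))), hxB]
    · simp [h, h', sameBlock_iff hB (hS (hgS i (hlt hi h))), hS (hgS j (hlt hj h'))]

/-- A partition avoids `β_{k,k-1}` if every block with at least `k - 1` elements is contiguous
from its `(k - 2)`-th element on. -/
theorem avoids_beta_pred {k n : ℕ} (hk : 3 ≤ k) {β : Finpartition (Idx k)}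
    (hβ : β.parts = {{k - 1}, Idx k \ {k - 1}}) {σ : Finpartition (Idx n)}
    (h : ∀ B ∈ σ.parts, k - 1 ≤ #B → ∀ x y z, x ∈ B → z ∈ B → x < y → y < z →
      k - 2 ≤ #{w ∈ B | w ≤ x} → y ∈ B) : Avoids σ β := by
  rintro ⟨f, hf, hfn, hfb⟩
  have hkI : k ∈ Idx k := mem_idx.2 (by omega)
  have hk1I : k - 1 ∈ Idx k := mem_idx.2 (by omega)
  have hk2I : k - 2 ∈ Idx k := mem_idx.2 (by omega)
  obtain ⟨B, hB, hkB⟩ := σ.exists_mem (hfn k hkI)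
  have hmem {i : ℕ} (hi : i ∈ Idx k) : f i ∈ B ↔ i ≠ k - 1 := by
    rw [← sameBlock_iff hB hkB, ← hfb k hkI i hi, sameBlock_iff_of_parts hβ hkI hi]
    have : k ≠ k - 1 := by omega
    simp [this]
  have hsub {i : ℕ} (hi : i ∈ Idx (k - 2)) : i ∈ Idx k := by
    rw [mem_idx] at hi ⊢; omega
  have hcard : k - 2 ≤ #{w ∈ B | w ≤ f (k - 2)} := by
    have : (Idx (k - 2)).image f ⊆ {w ∈ B | w ≤ f (k - 2)} := by
      intro w hw
      obtain ⟨i, hi, rfl⟩ := mem_image.1 hw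
      have hi' := mem_idx.1 hi
      exact mem_filter.2 ⟨(hmem (hsub hi)).2 (by omega),
        (hf.le_iff_le (hsub hi) hk2I).2 hi'.2⟩
    have := card_le_card this
    rwa [card_image_of_injOn (hf.injOn.mono fun i hi ↦ hsub hi), Idx, Nat.card_Icc,
      Nat.add_sub_cancel] at this
  have hlt : f (k - 2) < f (k - 1) := hf hk2I hk1I (by omega)
  have hlt' : f (k - 1) < f k := hf hk1I hkI (by omega)
  have hBcard : k - 1 ≤ #B := by
    have h1 := card_filter_le_lt hkB (hlt.trans hlt')
    have h2 := card_filter_le B (· ≤ f k)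
    omega
  exact (hmem hk1I).1 (h B hB hBcard _ _ _ ((hmem hk2I).2 (by omega)) hkB hlt hlt' hcard) rfl

/-- The permutation of `ℕ` exchanging the adjacent intervals `(a, a + u]` and `(a + u, a + u + t]`,
increasing on each of them. -/
def intervalSwap (a u t : ℕ) : Equiv.Perm ℕ where
  toFun x := if a < x ∧ x ≤ a + u then x + t else if a + u < x ∧ x ≤ a + u + t then x - u else x
  invFun x := if a < x ∧ x ≤ a + t then x + u else if a + t < x ∧ x ≤ a + t + u then x - t else x
  left_inv x := by dsimp only; split_ifs <;> omega
  right_inv x := by dsimp only; split_ifs <;> omega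

theorem intervalSwap_symm (a u t : ℕ) : (intervalSwap a u t).symm = intervalSwap a t u := rfl

theorem intervalSwap_apply (a u t x : ℕ) : intervalSwap a u t x =
    if a < x ∧ x ≤ a + u then x + t else if a + u < x ∧ x ≤ a + u + t then x - u else x := rfl

/-- The image of a set partition under a permutation preserving the ground set. -/
def relabel {n : ℕ} (e : Equiv.Perm ℕ) (he : ∀ x, e.symm x ∈ Idx n ↔ x ∈ Idx n)
    (σ : Finpartition (Idx n)) : Finpartition (Idx n) :=
  Finpartition.ofExistsUnique (σ.parts.image (·.map e.toEmbedding))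
    (by
      simp only [mem_image, forall_exists_index, and_imp, forall_apply_eq_imp_iff₂]
      intro B hB x hx
      rw [mem_map_equiv] at hx
      exact (he x).1 (σ.le hB hx))
    (by
      intro x hx
      obtain ⟨B, ⟨hB, hxB⟩, hu⟩ := σ.existsUnique_mem ((he x).2 hx)
      refine ⟨B.map e.toEmbedding, ⟨mem_image_of_mem _ hB, mem_map_equiv.2 hxB⟩, ?_⟩
      rintro C ⟨hC, hxC⟩
      obtain ⟨D, hD, rfl⟩ := mem_image.1 hC
      rw [hu D ⟨hD, mem_map_equiv.1 hxC⟩])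
    (by simp)

theorem parts_relabel {n : ℕ} (e : Equiv.Perm ℕ) (he : ∀ x, e.symm x ∈ Idx n ↔ x ∈ Idx n)
    (σ : Finpartition (Idx n)) :
    (relabel e he σ).parts = σ.parts.image (·.map e.toEmbedding) := rfl

/-- Either all blocks of `σ` have fewer than `r` elements (and `a = u = t = 0`), or exactly one
block does not; this block has `a` as its `(r - 1)`-th element, followed by `(a, a + t]`. -/
def HasTail {n : ℕ} (r a u t : ℕ) (σ : Finpartition (Idx n)) : Prop :=
  ((∀ B ∈ σ.parts, #B < r) ∧ a = 0 ∧ u = 0 ∧ t = 0) ∨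
    ∃ B ∈ σ.parts, r ≤ #B ∧ (∀ C ∈ σ.parts, r ≤ #C → C = B) ∧ a ∈ B ∧
      #{y ∈ B | y ≤ a} = r - 1 ∧ (∀ y, a < y → (y ∈ B ↔ y ≤ a + t)) ∧ a + u + t = n

theorem HasTail.unique {n r a u t a' u' t' : ℕ} {σ : Finpartition (Idx n)}
    (h : HasTail r a u t σ) (h' : HasTail r a' u' t' σ) : a = a' ∧ u = u' ∧ t = t' := by
  rcases h with ⟨h, rfl, rfl, rfl⟩ | ⟨B, hB, hBr, hBu, haB, hcard, htail, hn⟩ <;>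
    rcases h' with ⟨h', rfl, rfl, rfl⟩ | ⟨C, hC, hCr, hCu, haC, hcard', htail', hn'⟩
  · simp
  · exact absurd (h C hC) hCr.not_gt
  · exact absurd (h' B hB) hBr.not_gt
  · obtain rfl := hBu C hC hCr
    obtain rfl := eq_of_card_filter_le_eq haB haC (hcard.trans hcard'.symm)
    have h1 : t ≤ t' := by
      by_contra! ht
      have := (htail' _ (by omega)).1 ((htail (a + t) (by omega)).2 le_rfl)
      omega
    have h2 : t' ≤ t := by
      by_contra! ht
      have := (htail _ (by omega)).1 ((htail' (a + t') (by omega)).2 le_rfl)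
      omega
    omega

theorem HasTail.avoids {k n a u t : ℕ} (hk : 3 ≤ k) {β : Finpartition (Idx k)}
    (hβ : β.parts = {{k - 1}, Idx k \ {k - 1}}) {σ : Finpartition (Idx n)}
    (h : HasTail (k - 1) a u t σ) : Avoids σ β := by
  refine avoids_beta_pred hk hβ fun C hC hCk x y z hx hz hxy hyz hcx ↦ ?_
  rcases h with ⟨h, -⟩ | ⟨B, hB, hBr, hBu, haB, hcard, htail, -⟩
  · exact absurd (h C hC) hCk.not_gt
  · obtain rfl := hBu C hC hCk
    have hax : a ≤ x := by
      by_contra! hxa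
      have := card_filter_le_lt haB hxa
      omega
    have := (htail z (by omega)).1 hz
    exact (htail y (by omega)).2 (by omega)

theorem HasTail.eq_of_le_card {n r a u t : ℕ} {σ : Finpartition (Idx n)} (h : HasTail r a u t σ)
    {B C : Finset ℕ} (hB : B ∈ σ.parts) (hC : C ∈ σ.parts) (hBr : r ≤ #B) (hCr : r ≤ #C) :
    B = C := by
  rcases h with ⟨h, -⟩ | ⟨D, -, -, hD, -⟩
  · exact absurd (h B hB) hBr.not_gt
  · rw [hD B hB hBr, hD C hC hCr]

theorem exists_relabel_hasTail {k n : ℕ} (hk : 3 ≤ k) {β : Finpartition (Idx k)}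
    (hβ : β.parts = {{k}, Idx k \ {k}}) {σ : Finpartition (Idx n)} (hσ : Avoids σ β) :
    ∃ a u t, ∃ τ : Finpartition (Idx n), HasTail (k - 1) a u t τ ∧
      τ.parts = σ.parts.image (·.map (intervalSwap a u t).toEmbedding) := by
  by_cases hsmall : ∀ B ∈ σ.parts, #B < k - 1
  · refine ⟨0, 0, 0, σ, Or.inl ⟨hsmall, rfl, rfl, rfl⟩, ?_⟩
    have : (intervalSwap 0 0 0).toEmbedding = Function.Embedding.refl ℕ := by
      ext x
      simp [intervalSwap_apply]
    simp [this]
  push Not at hsmall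
  obtain ⟨B, hB, hBk⟩ := hsmall
  have hfull {C : Finset ℕ} {m : ℕ} (hC : C ∈ σ.parts) (hm : #{y ∈ C | y ≤ m} = k - 1)
      {x : ℕ} (hx : x ∈ Idx n) (hmx : m < x) : x ∈ C :=
    mem_of_avoids_beta_last hβ hσ hC (filter_subset (· ≤ m) _) hm hx
      fun s hs ↦ (mem_filter.1 hs).2.trans_lt hmx
  obtain ⟨m, hmB, hm⟩ := exists_card_filter_le_eq B (by omega) hBk
  obtain ⟨a, haB, ha⟩ := exists_card_filter_le_eq B (c := k - 2) (by omega) (by omega)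
  have ham : a < m := lt_of_card_filter_le_lt (ha.trans_lt (by omega))
  have hmn := mem_idx.1 (σ.le hB hmB)
  have htail {x : ℕ} (hax : a < x) (hxn : x ≤ n) : x ∈ B ↔ m ≤ x := by
    constructor
    · intro hx
      by_contra! hxm
      have h1 := card_filter_le_lt hx hax
      have h2 := card_filter_le_lt hmB hxm
      omega
    · intro hmx
      rcases hmx.eq_or_lt with rfl | hmx
      · exact hmB
      · exact hfull hB hm (mem_idx.2 (by omega)) hmx
  have huniq {C : Finset ℕ} (hC : C ∈ σ.parts) (hCk : k - 1 ≤ #C) : C = B := by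
    obtain ⟨l, hlC, hl⟩ := exists_card_filter_le_eq C (by omega) hCk
    rcases lt_trichotomy l m with h | rfl | h
    · exact σ.eq_of_mem_parts hC hB (hfull hC hl (σ.le hB hmB) h) hmB
    · exact σ.eq_of_mem_parts hC hB hlC hmB
    · exact σ.eq_of_mem_parts hC hB hlC (hfull hB hm (σ.le hC hlC) h)
  obtain ⟨u, rfl⟩ : ∃ u, m = a + u + 1 := ⟨m - a - 1, by omega⟩
  obtain ⟨t, ht⟩ : ∃ t, n = a + u + t := ⟨n - a - u, by omega⟩
  have ha0 := mem_idx.1 (σ.le hB haB)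
  have he (x : ℕ) : (intervalSwap a u t).symm x ∈ Idx n ↔ x ∈ Idx n := by
    rw [intervalSwap_symm, intervalSwap_apply, mem_idx, mem_idx]
    split_ifs <;> omega
  refine ⟨a, u, t, relabel (intervalSwap a u t) he σ, ?_, parts_relabel _ he σ⟩
  have hlow {y : ℕ} (hy : y ≤ a) : y ∈ B.map (intervalSwap a u t).toEmbedding ↔ y ∈ B := by
    rw [mem_map_equiv, intervalSwap_symm, intervalSwap_apply, if_neg (by omega),
      if_neg (by omega)]
  refine Or.inr ⟨B.map (intervalSwap a u t).toEmbedding, ?_, ?_, ?_, ?_, ?_, ?_, ht.symm⟩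
  · exact mem_image_of_mem _ hB
  · rwa [card_map]
  · simp only [parts_relabel, mem_image, forall_exists_index, and_imp,
      forall_apply_eq_imp_iff₂, card_map]
    intro C hC hCk
    rw [huniq hC hCk]
  · exact (hlow le_rfl).2 haB
  · have : {y ∈ B.map (intervalSwap a u t).toEmbedding | y ≤ a} = {y ∈ B | y ≤ a} := by
      ext y
      simp only [mem_filter]
      exact and_congr_left hlow
    rw [this, ha]
    omega
  · intro y hy
    rw [mem_map_equiv, intervalSwap_symm, intervalSwap_apply]
    by_cases hyt : y ≤ a + t
    · rw [if_pos ⟨hy, hyt⟩, htail (by omega) (by omega)]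
      omega
    · rw [if_neg (by omega)]
      refine iff_of_false ?_ hyt
      split_ifs with h
      · rw [htail (by omega) (by omega)]
        omega
      · intro hyB
        have := mem_idx.1 (σ.le hB hyB)
        omega

/-- The partition `{{1, …, r}, {r + 1, …, n}}`. -/
theorem exists_two_intervals {r n : ℕ} (hr : 0 < r) (hrn : r < n) :
    ∃ σ : Finpartition (Idx n), σ.parts = {Icc 1 r, Icc (r + 1) n} := by
  refine ⟨Finpartition.ofExistsUnique {Icc 1 r, Icc (r + 1) n} ?_ ?_ ?_, rfl⟩
  · simp only [mem_insert, mem_singleton, forall_eq_or_imp, forall_eq, Idx]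
    exact ⟨Icc_subset_Icc_right hrn.le, Icc_subset_Icc_left (by omega)⟩
  · intro x hx
    rw [mem_idx] at hx
    by_cases h : x ≤ r
    · refine ⟨Icc 1 r, by simp; omega, ?_⟩
      simp only [mem_insert, mem_singleton, and_imp]
      rintro C (rfl | rfl) hxC
      · rfl
      · rw [mem_Icc] at hxC; omega
    · refine ⟨Icc (r + 1) n, by simp; omega, ?_⟩
      simp only [mem_insert, mem_singleton, and_imp]
      rintro C (rfl | rfl) hxC
      · rw [mem_Icc] at hxC; omega
      · rfl
  · simp only [mem_insert, mem_singleton, not_or]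
    exact ⟨(nonempty_Icc.2 hr).ne_empty.symm, (nonempty_Icc.2 hrn).ne_empty.symm⟩

/-- For `n ≥ 2k - 2`, `|Π_n(β_{k,k})| < |Π_n(β_{k,k-1})|`. -/
theorem avoidCount_beta_k_lt_beta_pred (k : ℕ) (hk : 3 ≤ k)
    (βk βk1 : Finpartition (Idx k))
    (hβk : βk.parts = {{k}, Idx k \ {k}})
    (hβk1 : βk1.parts = {{k - 1}, Idx k \ {k - 1}}) :
    ∀ n : ℕ, 2 * k - 2 ≤ n → avoidCount n βk < avoidCount n βk1 := by
  intro n hn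
  choose a u t τ hτ hparts using
    fun σ : {σ : Finpartition (Idx n) // Avoids σ βk} ↦ exists_relabel_hasTail hk hβk σ.2
  let F : {σ : Finpartition (Idx n) // Avoids σ βk} → {σ : Finpartition (Idx n) // Avoids σ βk1} :=
    fun σ ↦ ⟨τ σ, (hτ σ).avoids hk hβk1⟩
  have hF : Function.Injective F := by
    intro σ σ' h
    have h : τ σ = τ σ' := congrArg Subtype.val h
    obtain ⟨ha, hu, ht⟩ := (hτ σ).unique (h ▸ hτ σ')
    have hp := hparts σ
    rw [h, hparts σ', ha, hu, ht] at hp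
    exact Subtype.ext (Finpartition.ext (image_injective (map_injective _) hp.symm))
  obtain ⟨ρ, hρ⟩ := exists_two_intervals (r := k - 1) (n := n) (by omega) (by omega)
  have hρ1 : Avoids ρ βk1 := by
    refine avoids_beta_pred hk hβk1 fun B hB _ x y z hx hz hxy hyz _ ↦ ?_
    rw [hρ, mem_insert, mem_singleton] at hB
    rcases hB with rfl | rfl <;> rw [mem_Icc] at hx hz ⊢ <;> omega
  have := Fintype.ofFinite {σ : Finpartition (Idx n) // Avoids σ βk}
  have := Fintype.ofFinite {σ : Finpartition (Idx n) // Avoids σ βk1}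
  rw [avoidCount, avoidCount, Nat.card_eq_fintype_card, Nat.card_eq_fintype_card]
  refine Fintype.card_lt_of_injective_of_notMem F hF (b := ⟨ρ, hρ1⟩) ?_
  rintro ⟨σ, hσ⟩
  have hτρ : τ σ = ρ := congrArg Subtype.val hσ
  have h := HasTail.eq_of_le_card (hτρ ▸ hτ σ) (B := Icc 1 (k - 1)) (C := Icc (k - 1 + 1) n)
    (by simp [hρ]) (by simp [hρ]) (by simp) (by simp; omega)
  have h1 : 1 ∈ Icc (k - 1 + 1) n := h ▸ mem_Icc.2 ⟨le_rfl, by omega⟩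
  rw [mem_Icc] at h1
  omega
end

section
/- Let k ≥ 4 and let σ be a set partition of [k] with exactly two blocks. Then for every n > k, |Π_n(σ)| < |Π_n(β_k)|, where β_k is the set partition of [k] with the single block [k]. -/
open Finset

section SameBlock

variable {n : ℕ} {π π' : Finpartition (Idx n)} {x y z : ℕ}

theorem sameBlock_iff_mem_part : SameBlock π x y ↔ x ∈ π.part y :=
  π.mem_part_iff_exists.symm

theorem SameBlock.symm (h : SameBlock π x y) : SameBlock π y x := by
  obtain ⟨B, hB, hx, hy⟩ := h
  exact ⟨B, hB, hy, hx⟩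

theorem SameBlock.trans (h : SameBlock π x y) (h' : SameBlock π y z) : SameBlock π x z := by
  obtain ⟨B, hB, hx, hy⟩ := h
  obtain ⟨C, hC, hy', hz⟩ := h'
  obtain rfl := π.eq_of_mem_parts hB hC hy hy'
  exact ⟨B, hB, hx, hz⟩

theorem SameBlock.left_mem (h : SameBlock π x y) : x ∈ Idx n := by
  obtain ⟨B, hB, hx, -⟩ := h
  exact π.le hB hx

theorem sameBlock_self : SameBlock π x x ↔ x ∈ Idx n := by
  rw [sameBlock_iff_mem_part, Finpartition.mem_part_self]

theorem sameBlock_iff_part_eq (hx : x ∈ Idx n) (hy : y ∈ Idx n) :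
    SameBlock π x y ↔ π.part x = π.part y := by
  rw [sameBlock_iff_mem_part, Finpartition.mem_part_iff_part_eq_part π hx hy]

theorem finpartition_eq_of_sameBlock_iff (h : ∀ x y, SameBlock π x y ↔ SameBlock π' x y) :
    π = π' := by
  have hpart : ∀ y, π.part y = π'.part y := fun y => by
    ext x
    rw [← sameBlock_iff_mem_part, ← sameBlock_iff_mem_part, h]
  have key : ∀ ρ ρ' : Finpartition (Idx n), (∀ y, ρ.part y = ρ'.part y) →
      ∀ B ∈ ρ.parts, B ∈ ρ'.parts := by
    intro ρ ρ' hρ B hB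
    obtain ⟨b, hb⟩ := ρ.nonempty_of_mem_parts hB
    rw [← ρ.part_eq_of_mem hB hb, hρ, Finpartition.part_mem]
    exact ρ.le hB hb
  ext B
  exact ⟨key π π' hpart B, key π' π (fun y => (hpart y).symm) B⟩

end SameBlock

open Classical in
/-- The partition of `[n]` into the colour classes of `C`. -/
noncomputable def partitionOfColoring (n : ℕ) {γ : Type*} (C : ℕ → γ) : Finpartition (Idx n) :=
  Finpartition.ofSetSetoid (Setoid.ker C) (Idx n)

theorem sameBlock_partitionOfColoring {n : ℕ} {γ : Type*} {C : ℕ → γ} {x y : ℕ} :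
    SameBlock (partitionOfColoring n C) x y ↔ x ∈ Idx n ∧ y ∈ Idx n ∧ C x = C y := by
  classical
  rw [sameBlock_iff_mem_part, partitionOfColoring,
    Finpartition.mem_part_ofSetSetoid_iff_rel, Setoid.ker_def]
  tauto

/-- A partition whose colour classes are all smaller than `k` avoids the one-block partition. -/
theorem avoids_of_color_classes_card_lt {n k : ℕ} (hk : 0 < k) {β : Finpartition (Idx k)}
    (hβ : β.parts = {Idx k}) {γ : Type*} [DecidableEq γ] {C : ℕ → γ}
    (hC : ∀ x ∈ Idx n, #{y ∈ Idx n | C y = C x} < k) :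
    Avoids (partitionOfColoring n C) β := by
  rintro ⟨f, hf, hmem, hfb⟩
  have h1 : 1 ∈ Idx k := by simp [Idx]; omega
  refine absurd (hC _ (hmem 1 h1)) (not_lt.2 ?_)
  calc k = #((Idx k).image f) := by
        rw [card_image_of_injOn hf.injOn]; simp [Idx]
    _ ≤ _ := card_le_card fun y hy => by
        obtain ⟨i, hi, rfl⟩ := mem_image.1 hy
        have := (hfb i hi 1 h1).1 ⟨Idx k, by simp [hβ], hi, h1⟩
        rw [sameBlock_partitionOfColoring] at this
        exact mem_filter.2 ⟨this.1, this.2.2⟩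

/-- `c` colours `X` with classes smaller than `k`, in such a way that every class other than
that of colour `0` forms, together with that of colour `0`, a copy of the two-block partition
of `[k]` one of whose blocks is `A`. -/
def IsStarColoring (k : ℕ) (A X : Finset ℕ) (c : ℕ → ℕ) : Prop :=
  (∀ v, #{x ∈ X | c x = v} < k) ∧
  ∀ x ∈ X, c x ≠ 0 → ∃ f : ℕ → ℕ, StrictMonoOn f (Idx k) ∧ (∀ i ∈ Idx k, f i ∈ X) ∧
    (∀ i ∈ Idx k, ∀ j ∈ Idx k, ((i ∈ A ↔ j ∈ A) ↔ c (f i) = c (f j))) ∧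
    (∃ i ∈ Idx k, c (f i) = 0) ∧ ∃ j ∈ Idx k, c (f j) = c x

/-- `x` and `y` lie in the same block of `ρ`, or both in blocks meeting a common copy of `σ`. -/
def Linked {k n : ℕ} (σ : Finpartition (Idx k)) (ρ : Finpartition (Idx n)) (x y : ℕ) : Prop :=
  SameBlock ρ x y ∨ ∃ f : ℕ → ℕ, StrictMonoOn f (Idx k) ∧ (∀ i ∈ Idx k, f i ∈ Idx n) ∧
    (∀ i ∈ Idx k, ∀ j ∈ Idx k, (SameBlock σ i j ↔ SameBlock ρ (f i) (f j))) ∧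
    (∃ i ∈ Idx k, SameBlock ρ x (f i)) ∧ ∃ j ∈ Idx k, SameBlock ρ (f j) y

section TwoBlocks

variable {k n : ℕ} {σ : Finpartition (Idx k)} {A : Finset ℕ}

/-- Within a star-coloured set all elements are linked. -/
theorem eqvGen_linked_of_isStarColoring
    (hσA : ∀ i ∈ Idx k, ∀ j ∈ Idx k, (SameBlock σ i j ↔ (i ∈ A ↔ j ∈ A)))
    {X : Finset ℕ} (hX : X ⊆ Idx n) {c : ℕ → ℕ} (hc : IsStarColoring k A X c)
    {ρ : Finpartition (Idx n)} (hρ : ∀ x ∈ X, ∀ y ∈ X, (SameBlock ρ x y ↔ c x = c y))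
    {x y : ℕ} (hx : x ∈ X) (hy : y ∈ X) : Relation.EqvGen (Linked σ ρ) x y := by
  by_cases hconst : ∀ x ∈ X, c x = 0
  · exact .rel _ _ (.inl ((hρ x hx y hy).2 (by rw [hconst x hx, hconst y hy])))
  obtain ⟨z, hz, hcz⟩ : ∃ z ∈ X, c z = 0 := by
    push Not at hconst
    obtain ⟨w, hw, hcw⟩ := hconst
    obtain ⟨f, -, hfX, -, ⟨i, hi, hci⟩, -⟩ := hc.2 w hw hcw
    exact ⟨f i, hfX i hi, hci⟩
  have hub : ∀ w ∈ X, Relation.EqvGen (Linked σ ρ) w z := by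
    intro w hw
    refine .rel _ _ ?_
    by_cases hcw : c w = 0
    · exact .inl ((hρ w hw z hz).2 (hcw.trans hcz.symm))
    obtain ⟨f, hf, hfX, hfA, ⟨i, hi, hci⟩, ⟨j, hj, hcj⟩⟩ := hc.2 w hw hcw
    refine .inr ⟨f, hf, fun l hl => hX (hfX l hl), fun l hl m hm => ?_,
      ⟨j, hj, (hρ _ hw _ (hfX j hj)).2 hcj.symm⟩,
      ⟨i, hi, (hρ _ (hfX i hi) _ hz).2 (hci.trans hcz.symm)⟩⟩
    rw [hσA l hl m hm, hρ _ (hfX l hl) _ (hfX m hm), hfA l hl m hm]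
  exact (hub x hx).trans _ _ _ ((hub y hy).symm _ _)

/-- If `π` avoids a two-block partition `σ`, then copies of `σ` in a refinement of `π`
lie inside a single block of `π`. -/
theorem sameBlock_of_eqvGen_linked
    (hσA : ∀ i ∈ Idx k, ∀ j ∈ Idx k, (SameBlock σ i j ↔ (i ∈ A ↔ j ∈ A)))
    {π ρ : Finpartition (Idx n)} (hπ : Avoids π σ)
    (hρ : ∀ x y, SameBlock ρ x y → SameBlock π x y) {x y : ℕ}
    (h : Relation.EqvGen (Linked σ ρ) x y) (hx : x ∈ Idx n) :
    SameBlock π x y := by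
  suffices x = y ∨ SameBlock π x y by
    rcases this with rfl | h
    · exact sameBlock_self.2 hx
    · exact h
  clear hx
  induction h with
  | refl x => exact .inl rfl
  | symm x y _ ih =>
    rcases ih with rfl | h
    · exact .inl rfl
    · exact .inr h.symm
  | trans x y z _ _ ih ih' =>
    rcases ih with rfl | h
    · exact ih'
    · rcases ih' with rfl | h'
      · exact .inr h
      · exact .inr (h.trans h')
  | rel x y hxy =>
    right
    rcases hxy with h | ⟨f, hf, hfn, hfσ, ⟨i, hi, hxi⟩, ⟨j, hj, hjy⟩⟩
    · exact hρ _ _ h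
    refine (hρ _ _ hxi).trans (SameBlock.trans ?_ (hρ _ _ hjy))
    by_contra hij
    refine hπ ⟨f, hf, hfn, fun l hl m hm => ⟨fun h => hρ _ _ ((hfσ l hl m hm).1 h), fun hlm => ?_⟩⟩
    by_contra hnot
    have hall : ∀ p ∈ Idx k, SameBlock π (f p) (f l) := by
      intro p hp
      rw [hσA l hl m hm] at hnot
      by_cases hpl : p ∈ A ↔ l ∈ A
      · exact hρ _ _ ((hfσ p hp l hl).1 ((hσA p hp l hl).2 hpl))
      · have hpm : p ∈ A ↔ m ∈ A := by tauto
        exact (hρ _ _ ((hfσ p hp m hm).1 ((hσA p hp m hm).2 hpm))).trans hlm.symm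
    exact hij ((hall i hi).trans (hall j hj).symm)

/-- Refining every block of a `σ`-avoiding partition by a star colouring is an injective map to
`β`-avoiding partitions, which misses one of the partitions induced by two different star
colourings of `[n]`. -/
theorem avoidCount_lt_of_isStarColoring
    (hσA : ∀ i ∈ Idx k, ∀ j ∈ Idx k, (SameBlock σ i j ↔ (i ∈ A ↔ j ∈ A)))
    (hk : 0 < k) {β : Finpartition (Idx k)} (hβ : β.parts = {Idx k})
    (hex : ∀ X, ∃ c, IsStarColoring k A X c)
    (htwo : ∃ c c', IsStarColoring k A (Idx n) c ∧ IsStarColoring k A (Idx n) c' ∧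
      ∃ x ∈ Idx n, ∃ y ∈ Idx n, c x = c y ∧ c' x ≠ c' y) :
    avoidCount n σ < avoidCount n β := by
  classical
  choose c hc using hex
  let C (π : Finpartition (Idx n)) (x : ℕ) : Finset ℕ × ℕ := (π.part x, c (π.part x) x)
  have hC : ∀ π x, x ∈ Idx n → ∀ y ∈ Idx n, (C π y = C π x ↔
      y ∈ π.part x ∧ c (π.part x) y = c (π.part x) x) := by
    intro π x hx y hy
    rw [Finpartition.mem_part_iff_part_eq_part π hy hx]
    simp only [C, Prod.mk.injEq]
    exact and_congr_right fun h => by rw [h]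
  have havoid : ∀ π, Avoids (partitionOfColoring n (C π)) β := by
    refine fun π => avoids_of_color_classes_card_lt hk hβ fun x hx => ?_
    refine lt_of_le_of_lt (card_le_card fun y hy => ?_) ((hc (π.part x)).1 (c (π.part x) x))
    rw [mem_filter] at hy ⊢
    exact (hC π x hx y hy.1).1 hy.2
  have hrecover : ∀ π, Avoids π σ → ∀ x ∈ Idx n, ∀ y, (SameBlock π x y ↔
      y ∈ Idx n ∧ Relation.EqvGen (Linked σ (partitionOfColoring n (C π))) x y) := by
    intro π hπ x hx y
    constructor
    · intro h
      refine ⟨h.symm.left_mem, eqvGen_linked_of_isStarColoring hσA (π.part_subset x)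
        (hc (π.part x)) ?_ ?_ ?_⟩
      · intro u hu v hv
        have hu' := π.part_subset x hu
        have hv' := π.part_subset x hv
        have h1 := (Finpartition.mem_part_iff_part_eq_part π hu' hx).1 hu
        have h2 := (Finpartition.mem_part_iff_part_eq_part π hv' hx).1 hv
        rw [sameBlock_partitionOfColoring]
        simp [C, h1, h2, hu', hv']
      · exact π.mem_part hx
      · exact sameBlock_iff_mem_part.1 h.symm
    · rintro ⟨-, h⟩
      refine sameBlock_of_eqvGen_linked hσA hπ ?_ h hx
      intro u v huv
      rw [sameBlock_partitionOfColoring] at huv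
      rw [sameBlock_iff_part_eq huv.1 huv.2.1]
      exact congrArg Prod.fst huv.2.2
  let F : {π : Finpartition (Idx n) // Avoids π σ} → {π : Finpartition (Idx n) // Avoids π β} :=
    fun π => ⟨partitionOfColoring n (C π.1), havoid π.1⟩
  have hrecover' : ∀ π π' : {π : Finpartition (Idx n) // Avoids π σ},
      (∀ x ∈ Idx n, ∀ y ∈ Idx n, (Relation.EqvGen (Linked σ (F π).1) x y ↔
        Relation.EqvGen (Linked σ (F π').1) x y)) → π = π' := by
    intro π π' h
    refine Subtype.ext (finpartition_eq_of_sameBlock_iff fun x y => ?_)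
    by_cases hx : x ∈ Idx n
    · rw [hrecover _ π.2 x hx, hrecover _ π'.2 x hx]
      exact and_congr_right fun hy => h x hx y hy
    · exact iff_of_false (fun h => hx h.left_mem) (fun h => hx h.left_mem)
  have hinj : Function.Injective F := fun π π' h => hrecover' π π' (by rw [h]; simp)
  have hsurj : ¬ Function.Surjective F := by
    intro hs
    obtain ⟨d, d', hd, hd', x, hx, y, hy, hxy, hxy'⟩ := htwo
    have key : ∀ e, IsStarColoring k A (Idx n) e → ∃ π, (F π).1 = partitionOfColoring n e ∧
        ∀ x ∈ Idx n, ∀ y ∈ Idx n, Relation.EqvGen (Linked σ (F π).1) x y := by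
      intro e he
      obtain ⟨π, hπ⟩ := hs ⟨partitionOfColoring n e, avoids_of_color_classes_card_lt hk hβ
        fun x _ => he.1 (e x)⟩
      refine ⟨π, congrArg Subtype.val hπ, fun x hx y hy => ?_⟩
      rw [hπ]
      refine eqvGen_linked_of_isStarColoring hσA subset_rfl he (fun u hu v hv => ?_) hx hy
      rw [sameBlock_partitionOfColoring]
      simp [hu, hv]
    obtain ⟨π, hπ, hall⟩ := key d hd
    obtain ⟨π', hπ', hall'⟩ := key d' hd'
    obtain rfl := hrecover' π π' fun x hx y hy => iff_of_true (hall x hx y hy) (hall' x hx y hy)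
    have h1 : SameBlock (partitionOfColoring n d') x y := by
      rw [← hπ', hπ, sameBlock_partitionOfColoring]
      exact ⟨hx, hy, hxy⟩
    rw [sameBlock_partitionOfColoring] at h1
    exact hxy' h1.2.2
  rw [avoidCount, avoidCount, Nat.card_eq_fintype_card, Nat.card_eq_fintype_card]
  exact Fintype.card_lt_of_injective_not_surjective F hinj hsurj

end TwoBlocks

/-- The word obtained from `[k]` by replacing every element of `A` by `t` copies of itself and
appending `R` extra elements, as a lexicographically ordered set of pairs. -/
def blowUp (k : ℕ) (A : Finset ℕ) (t R : ℕ) : Finset (ℕ ×ₗ ℕ) :=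
  ((Idx k \ A) ×ˢ {0} ∪ A ×ˢ range t ∪ {k + 1} ×ˢ range R).map toLex.toEmbedding

/-- The colouring of `blowUp k A t R` that is `0` outside the copies of `A` and the extra elements,
`h j` on the `j`-th copy of `A` and `e j` on the `j`-th extra element. -/
def blowUpColor (k : ℕ) (A : Finset ℕ) (h e : ℕ → ℕ) (p : ℕ ×ₗ ℕ) : ℕ :=
  if (ofLex p).1 = k + 1 then e (ofLex p).2 else if (ofLex p).1 ∈ A then h (ofLex p).2 else 0

section BlowUp

variable {k : ℕ} {A : Finset ℕ} {t R : ℕ} {h e : ℕ → ℕ}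

theorem toLex_mem_blowUp {i j : ℕ} : toLex (i, j) ∈ blowUp k A t R ↔
    (i ∈ Idx k ∧ i ∉ A ∧ j = 0) ∨ (i ∈ A ∧ j < t) ∨ (i = k + 1 ∧ j < R) := by
  rw [blowUp, mem_map_equiv]
  simp only [toLex_symm_eq, ofLex_toLex, mem_union, mem_product, mem_sdiff, mem_singleton,
    mem_range, and_assoc, or_assoc]

theorem succ_notMem_idx : k + 1 ∉ Idx k := by simp [Idx]

theorem card_blowUp (hA : A ⊆ Idx k) : #(blowUp k A t R) = (k - #A) + #A * t + R := by
  have hk : k + 1 ∉ A := fun h => succ_notMem_idx (hA h)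
  rw [blowUp, card_map, card_union_of_disjoint, card_union_of_disjoint, card_product,
    card_product, card_product, card_sdiff_of_subset hA]
  · simp [Idx]
  · rw [disjoint_left]
    rintro ⟨i, j⟩ h1 h2
    simp only [mem_product, mem_sdiff] at h1 h2
    exact h1.1.2 h2.1
  · rw [disjoint_left]
    rintro ⟨i, j⟩ h1 h2
    simp only [mem_union, mem_product, mem_sdiff, mem_singleton] at h1 h2
    obtain rfl := h2.1
    rcases h1 with h1 | h1
    · exact succ_notMem_idx h1.1.1
    · exact hk h1.1

theorem card_blowUpColor_lt (hA : A ⊆ Idx k) (hh : ∀ j, h j ≠ 0)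
    (h0 : (k - #A) + #{j ∈ range R | e j = 0} < k)
    (hv : ∀ v ≠ 0, #A * #{j ∈ range t | h j = v} + #{j ∈ range R | e j = v} < k) (v : ℕ) :
    #{p ∈ blowUp k A t R | blowUpColor k A h e p = v} < k := by
  have hk : k + 1 ∉ A := fun h => succ_notMem_idx (hA h)
  rcases eq_or_ne v 0 with rfl | hv0
  · refine lt_of_le_of_lt ?_ h0
    calc _ ≤ #(((Idx k \ A) ×ˢ {0} ∪ {k + 1} ×ˢ {j ∈ range R | e j = 0}).map
          (toLex : ℕ × ℕ ≃ ℕ ×ₗ ℕ).toEmbedding) := card_le_card ?_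
      _ ≤ _ := by
        rw [card_map]
        refine (card_union_le _ _).trans ?_
        rw [card_product, card_product, card_sdiff_of_subset hA]
        simp [Idx]
    intro p hp
    obtain ⟨⟨i, j⟩, rfl⟩ := toLex.surjective p
    rw [mem_filter, toLex_mem_blowUp] at hp
    obtain ⟨hp | hp | hp, hc⟩ := hp
    · simp [hp.1, hp.2.1, hp.2.2]
    · have : i ≠ k + 1 := fun h => hk (h ▸ hp.1)
      simp [blowUpColor, hp.1, this, hh] at hc
    · simp [blowUpColor, hp.1] at hc
      simp [hp.1, hp.2, hc]
  · refine lt_of_le_of_lt ?_ (hv v hv0)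
    calc _ ≤ #((A ×ˢ {j ∈ range t | h j = v} ∪ {k + 1} ×ˢ {j ∈ range R | e j = v}).map
          (toLex : ℕ × ℕ ≃ ℕ ×ₗ ℕ).toEmbedding) := card_le_card ?_
      _ ≤ _ := by
        rw [card_map]
        refine (card_union_le _ _).trans ?_
        rw [card_product, card_product]
        simp
    intro p hp
    obtain ⟨⟨i, j⟩, rfl⟩ := toLex.surjective p
    rw [mem_filter, toLex_mem_blowUp] at hp
    obtain ⟨hp | hp | hp, hc⟩ := hp
    · have : i ≠ k + 1 := fun h => succ_notMem_idx (h ▸ hp.1)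
      simp [blowUpColor, hp.2.1, this] at hc
      exact absurd hc.symm hv0
    · have : i ≠ k + 1 := fun h => hk (h ▸ hp.1)
      simp [blowUpColor, hp.1, this] at hc
      simp [hp.1, hp.2, hc]
    · simp [blowUpColor, hp.1] at hc
      simp [hp.1, hp.2, hc]

/-- Two finite linear orders of the same size are isomorphic. -/
theorem exists_orderIso_of_card_eq {α : Type*} [LinearOrder α] [Nonempty α] {X : Finset ℕ}
    {S : Finset α} (hX : #X = #S) :
    ∃ (g : ℕ → α) (u : α → ℕ), (∀ x ∈ X, g x ∈ S) ∧ (∀ p ∈ S, u p ∈ X) ∧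
      (∀ x ∈ X, u (g x) = x) ∧ (∀ p ∈ S, g (u p) = p) ∧ StrictMonoOn u S := by
  classical
  let φ : X ≃o S := (X.orderIsoOfFin rfl).symm.trans (S.orderIsoOfFin hX.symm)
  refine ⟨fun x => if hx : x ∈ X then φ ⟨x, hx⟩ else Classical.arbitrary α,
    fun p => if hp : p ∈ S then φ.symm ⟨p, hp⟩ else 0, ?_, ?_, ?_, ?_, ?_⟩
  · intro x hx; simp [hx]
  · intro p hp; simp [hp]
  · intro x hx; simp [hx]
  · intro p hp; simp [hp]
  · intro p hp q hq hpq
    rw [mem_coe] at hp hq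
    simp only [hp, hq, dif_pos, Subtype.coe_lt_coe, OrderIso.lt_iff_lt]
    exact hpq

theorem isStarColoring_blowUpColor (hA : A ⊆ Idx k) (hA0 : A.Nonempty) (hA1 : A ≠ Idx k)
    (hh : ∀ j, h j ≠ 0)
    (he : ∀ j < R, e j = 0 ∨ ∃ j' < t, h j' = e j)
    (h0 : (k - #A) + #{j ∈ range R | e j = 0} < k)
    (hv : ∀ v ≠ 0, #A * #{j ∈ range t | h j = v} + #{j ∈ range R | e j = v} < k)
    {X : Finset ℕ} {g : ℕ → ℕ ×ₗ ℕ} {u : ℕ ×ₗ ℕ → ℕ}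
    (hg : ∀ x ∈ X, g x ∈ blowUp k A t R) (hu : ∀ p ∈ blowUp k A t R, u p ∈ X)
    (hug : ∀ x ∈ X, u (g x) = x) (hgu : ∀ p ∈ blowUp k A t R, g (u p) = p)
    (hmono : StrictMonoOn u (blowUp k A t R)) :
    IsStarColoring k A X (fun x => blowUpColor k A h e (g x)) := by
  have hk : k + 1 ∉ A := fun h => succ_notMem_idx (hA h)
  constructor
  · intro v
    refine lt_of_le_of_lt ?_ (card_blowUpColor_lt hA hh h0 hv v)
    refine card_le_card_of_injOn g ?_ ?_
    · intro x hx
      simp only [coe_filter, Set.mem_ofPred_eq] at hx ⊢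
      exact ⟨hg x hx.1, hx.2⟩
    · intro x hx y hy hxy
      simp only [coe_filter, Set.mem_ofPred_eq] at hx hy
      rw [← hug x hx.1, hxy, hug y hy.1]
  · intro x hx hx0
    change blowUpColor k A h e (g x) ≠ 0 at hx0
    obtain ⟨j, hj, hjx⟩ : ∃ j < t, h j = blowUpColor k A h e (g x) := by
      have hgx := hg x hx
      generalize g x = p at hgx hx0 ⊢
      obtain ⟨⟨i, j⟩, rfl⟩ := toLex.surjective p
      rw [toLex_mem_blowUp] at hgx
      rcases hgx with hp | hp | hp
      · have : i ≠ k + 1 := fun h => succ_notMem_idx (h ▸ hp.1)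
        simp [blowUpColor, hp.2.1, this] at hx0
      · have : i ≠ k + 1 := fun h => hk (h ▸ hp.1)
        exact ⟨j, hp.2, by simp [blowUpColor, this, hp.1]⟩
      · simp only [blowUpColor, ofLex_toLex, hp.1, if_pos] at hx0 ⊢
        exact (he j hp.2).resolve_left hx0
    let F : ℕ → ℕ ×ₗ ℕ := fun i => toLex (i, if i ∈ A then j else 0)
    have hF : ∀ i ∈ Idx k, F i ∈ blowUp k A t R := by
      intro i hi
      by_cases hiA : i ∈ A <;> simp [F, toLex_mem_blowUp, hi, hiA, hj]
    have hcol : ∀ i ∈ Idx k, blowUpColor k A h e (g (u (F i))) = if i ∈ A then h j else 0 := by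
      intro i hi
      rw [hgu _ (hF i hi)]
      have : i ≠ k + 1 := fun h => succ_notMem_idx (h ▸ hi)
      by_cases hiA : i ∈ A <;> simp [blowUpColor, F, this, hiA]
    refine ⟨fun i => u (F i), ?_, fun i hi => hu _ (hF i hi), ?_, ?_, ?_⟩
    · intro i hi i' hi' hii'
      refine hmono (hF i hi) (hF i' hi') ?_
      rw [Prod.Lex.toLex_lt_toLex]
      exact .inl hii'
    · intro i hi i' hi'
      simp only [hcol i hi, hcol i' hi']
      have := hh j
      by_cases hiA : i ∈ A <;> by_cases hiA' : i' ∈ A <;> simp [hiA, hiA', this, this.symm]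
    · obtain ⟨i, hi, hiA⟩ := exists_of_ssubset (hA.ssubset_of_ne hA1)
      exact ⟨i, hi, by simp only [hcol i hi, if_neg hiA]⟩
    · obtain ⟨i, hi⟩ := hA0
      exact ⟨i, hA hi, by simp only [hcol i (hA hi), if_pos hi, hjx]⟩

theorem card_filter_range_succ_eq_le (t v : ℕ) : #{j ∈ range t | j + 1 = v} ≤ 1 :=
  card_le_one.2 fun a ha b hb => by
    have := (mem_filter.1 ha).2
    have := (mem_filter.1 hb).2
    omega

/-- A set with more than `k` elements has two star colourings with different classes. -/
theorem exists_two_isStarColoring (hk : 4 ≤ k) (hA : A ⊆ Idx k) (hA0 : A.Nonempty)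
    (hA2 : 2 * #A ≤ k) {X : Finset ℕ} (hX : k < #X) :
    ∃ c c', IsStarColoring k A X c ∧ IsStarColoring k A X c' ∧
      ∃ x ∈ X, ∃ y ∈ X, c x = c y ∧ c' x ≠ c' y := by
  have hkA : k + 1 ∉ A := fun h => succ_notMem_idx (hA h)
  have ha : 0 < #A := hA0.card_pos
  have hA1 : A ≠ Idx k := by
    rintro rfl
    simp [Idx] at hA2
    omega
  obtain ⟨i₀, hi₀, hi₀A⟩ := exists_of_ssubset (hA.ssubset_of_ne hA1)
  obtain ⟨i₁, hi₁⟩ := hA0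
  have hi₀k : i₀ ≠ k + 1 := fun h => succ_notMem_idx (h ▸ hi₀)
  have hi₁k : i₁ ≠ k + 1 := fun h => hkA (h ▸ hi₁)
  rcases Nat.lt_or_ge 1 #A with ha1 | ha1
  · obtain ⟨M, hM⟩ : ∃ M, #X = (k - #A) + 1 + M := ⟨#X - (k - #A) - 1, by omega⟩
    have hdiv := Nat.div_add_mod M #A
    have hmod := Nat.mod_lt M ha
    have ht : 0 < M / #A := Nat.div_pos (by omega) ha
    generalize M / #A = t at hdiv ht
    generalize M % #A = r at hdiv hmod
    obtain ⟨g, u, hg, hu, hug, hgu, hmono⟩ := exists_orderIso_of_card_eq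
      (X := X) (S := blowUp k A t (r + 1)) (by rw [card_blowUp hA]; omega)
    have hp : toLex (i₀, 0) ∈ blowUp k A t (r + 1) := by simp [toLex_mem_blowUp, hi₀, hi₀A]
    have hq : toLex (k + 1, r) ∈ blowUp k A t (r + 1) := by simp [toLex_mem_blowUp]
    refine ⟨_, _, isStarColoring_blowUpColor (h := fun j => j + 1)
      (e := fun j => if j = r then 0 else 1) hA ⟨i₁, hi₁⟩ hA1 (by simp) ?_ ?_ ?_
      hg hu hug hgu hmono, isStarColoring_blowUpColor (h := fun j => j + 1)
      (e := fun j => if j = r then 1 else if j = 0 then 0 else 1) hA ⟨i₁, hi₁⟩ hA1 (by simp)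
      ?_ ?_ ?_ hg hu hug hgu hmono, u (toLex (i₀, 0)), hu _ hp, u (toLex (k + 1, r)), hu _ hq,
      ?_, ?_⟩
    · intro j _
      by_cases hjr : j = r
      · exact .inl (if_pos hjr)
      · exact .inr ⟨0, ht, by simp [hjr]⟩
    · have : #{j ∈ range (r + 1) | (if j = r then 0 else 1) = 0} ≤ 1 :=
        card_le_one.2 fun j hj j' hj' => by
          simp only [mem_filter] at hj hj'
          grind
      omega
    · intro v hv
      have h1 := Nat.mul_le_mul_left #A (card_filter_range_succ_eq_le t v)
      have : #{j ∈ range (r + 1) | (if j = r then 0 else 1) = v} ≤ #(range r) :=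
        card_le_card fun j hj => by
          simp only [mem_filter, mem_range] at hj ⊢
          grind
      rw [card_range] at this
      omega
    · intro j _
      by_cases hjr : j = r
      · exact .inr ⟨0, ht, by simp [hjr]⟩
      · by_cases hj0 : j = 0
        · exact .inl (by rw [if_neg hjr, if_pos hj0])
        · exact .inr ⟨0, ht, by simp [hjr, hj0]⟩
    · have : #{j ∈ range (r + 1) | (if j = r then 1 else if j = 0 then 0 else 1) = 0} ≤ 1 :=
        card_le_one.2 fun j hj j' hj' => by
          simp only [mem_filter] at hj hj'
          grind
      omega
    · intro v hv
      have h1 := Nat.mul_le_mul_left #A (card_filter_range_succ_eq_le t v)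
      have : #{j ∈ range (r + 1) | (if j = r then 1 else if j = 0 then 0 else 1) = v} ≤
          #(insert r (Ico 1 r)) :=
        card_le_card fun j hj => by
          simp only [mem_filter, mem_range, mem_insert, mem_Ico] at hj ⊢
          grind
      have h2 := this.trans (card_insert_le _ _)
      rw [Nat.card_Ico] at h2
      omega
    · simp only [hgu _ hp, hgu _ hq]
      simp [blowUpColor, hi₀k, hi₀A]
    · simp only [hgu _ hp, hgu _ hq]
      simp [blowUpColor, hi₀k, hi₀A]
  · have ha1 : #A = 1 := by omega
    obtain ⟨t, ht⟩ : ∃ t, #X = (k - #A) + #A * t + 0 := ⟨#X - (k - 1), by rw [ha1]; omega⟩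
    have ht2 : 2 ≤ t := by rw [ha1] at ht; omega
    obtain ⟨g, u, hg, hu, hug, hgu, hmono⟩ := exists_orderIso_of_card_eq
      (X := X) (S := blowUp k A t 0) (by rw [card_blowUp hA]; exact ht)
    have hp : toLex (i₁, 0) ∈ blowUp k A t 0 := by simp [toLex_mem_blowUp, hi₁]; omega
    have hq : toLex (i₁, 1) ∈ blowUp k A t 0 := by simp [toLex_mem_blowUp, hi₁]; omega
    have h0 : (k - #A) + #{j ∈ range 0 | (fun _ => 0 : ℕ → ℕ) j = 0} < k := by
      rw [range_zero, filter_empty, card_empty]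
      omega
    refine ⟨_, _, isStarColoring_blowUpColor (h := fun j => max j 1)
      (e := fun _ => 0) hA ⟨i₁, hi₁⟩ hA1 (fun j => by omega) (by simp)
      h0 ?_
      hg hu hug hgu hmono, isStarColoring_blowUpColor (h := fun j => j + 1)
      (e := fun _ => 0) hA ⟨i₁, hi₁⟩ hA1 (by simp) (by simp) h0 ?_
      hg hu hug hgu hmono, u (toLex (i₁, 0)), hu _ hp, u (toLex (i₁, 1)), hu _ hq, ?_, ?_⟩
    · intro v _
      have : #{j ∈ range t | max j 1 = v} ≤ #({0, v} : Finset ℕ) :=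
        card_le_card fun j hj => by
          simp only [mem_filter, mem_range, mem_insert, mem_singleton] at hj ⊢
          omega
      have h2 := this.trans card_le_two
      rw [ha1, range_zero, filter_empty, card_empty]
      omega
    · intro v _
      have := card_filter_range_succ_eq_le t v
      simp [ha1]
      omega
    · simp only [hgu _ hp, hgu _ hq]
      simp [blowUpColor, hi₁k, hi₁]
    · simp only [hgu _ hp, hgu _ hq]
      simp [blowUpColor, hi₁k, hi₁]

theorem exists_isStarColoring (hk : 4 ≤ k) (hA : A ⊆ Idx k) (hA0 : A.Nonempty)
    (hA2 : 2 * #A ≤ k) (X : Finset ℕ) : ∃ c, IsStarColoring k A X c := by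
  have ha : 0 < #A := hA0.card_pos
  rcases lt_trichotomy #X k with hX | hX | hX
  · exact ⟨fun _ => 0, fun v => (card_filter_le _ _).trans_lt hX, fun x _ h => absurd rfl h⟩
  · have hA1 : A ≠ Idx k := by
      rintro rfl
      simp [Idx] at hA2
      omega
    obtain ⟨g, u, hg, hu, hug, hgu, hmono⟩ := exists_orderIso_of_card_eq
      (X := X) (S := blowUp k A 1 0) (by rw [card_blowUp hA]; omega)
    have h0 : (k - #A) + #{j ∈ range 0 | (fun _ => 0 : ℕ → ℕ) j = 0} < k := by
      rw [range_zero, filter_empty, card_empty]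
      omega
    refine ⟨_, isStarColoring_blowUpColor (h := fun _ => 1) (e := fun _ => 0) hA hA0 hA1
      (by simp) (by simp) h0 ?_ hg hu hug hgu hmono⟩
    intro v _
    have : #{j ∈ range 1 | 1 = v} ≤ 1 := (card_filter_le _ _).trans (by simp)
    have := Nat.mul_le_mul_left #A this
    simp only [range_zero, filter_empty, card_empty]
    omega
  · obtain ⟨c, -, hc, -⟩ := exists_two_isStarColoring hk hA hA0 hA2 hX
    exact ⟨c, hc⟩

end BlowUp

/-- One of the blocks of a two-block partition of `[k]` has at most `k / 2` elements. -/
theorem exists_small_block {k : ℕ} {σ : Finpartition (Idx k)} (hσ : #σ.parts = 2) :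
    ∃ A ⊆ Idx k, A.Nonempty ∧ 2 * #A ≤ k ∧
      ∀ i ∈ Idx k, ∀ j ∈ Idx k, (SameBlock σ i j ↔ (i ∈ A ↔ j ∈ A)) := by
  obtain ⟨A, B, hAB, hparts⟩ := card_eq_two.1 hσ
  wlog hle : #A ≤ #B generalizing A B
  · exact this B A hAB.symm (by rw [hparts, pair_comm]) (le_of_not_ge hle)
  have hAm : A ∈ σ.parts := by simp [hparts]
  have hBm : B ∈ σ.parts := by simp [hparts]
  have hcard : #A + #B = k := by
    have := σ.sum_card_parts
    rw [hparts, sum_pair hAB] at this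
    simpa [Idx] using this
  refine ⟨A, σ.le hAm, σ.nonempty_of_mem_parts hAm, by omega, ?_⟩
  have hmem : ∀ i ∈ Idx k, (i ∈ B ↔ i ∉ A) := by
    intro i hi
    refine ⟨fun hB hA => hAB (σ.eq_of_mem_parts hAm hBm hA hB), fun hA => ?_⟩
    obtain ⟨C, ⟨hC, hiC⟩, -⟩ := σ.existsUnique_mem hi
    rw [hparts, mem_insert, mem_singleton] at hC
    rcases hC with rfl | rfl
    · exact absurd hiC hA
    · exact hiC
  intro i hi j hj
  have h1 := hmem i hi
  have h2 := hmem j hj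
  simp only [SameBlock, hparts, mem_insert, mem_singleton, exists_eq_or_imp, exists_eq_left]
  tauto

/-- If `σ ⊢ [k]` has exactly two blocks then `|Π_n(σ)| < |Π_n(β_k)|` for all `n > k`. -/
theorem avoidCount_twoBlocks_lt_beta (k : ℕ) (hk : 4 ≤ k)
    (σ : Finpartition (Idx k)) (hσ : σ.parts.card = 2)
    (β : Finpartition (Idx k)) (hβ : β.parts = {Idx k}) :
    ∀ n : ℕ, k < n → avoidCount n σ < avoidCount n β := by
  intro n hn
  obtain ⟨A, hA, hA0, hA2, hσA⟩ := exists_small_block hσ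
  exact avoidCount_lt_of_isStarColoring hσA (by omega) hβ
    (exists_isStarColoring hk hA hA0 hA2)
    (exists_two_isStarColoring hk hA hA0 hA2 (by simpa [Idx] using hn))
end

section
/- Let k ≥ 2 and let α be a set partition of [k−1]. Suppose that |Π_n(α)| < |Π_n(σ_{k−1})| for all n > k−1, where σ_m denotes the set partition of [m] all of whose blocks are singletons. Let 1/α′ be the set partition of [k] whose blocks are {1} together with the blocks of α each shifted up by 1, and let α/k be the set partition of [k] whose blocks are the blocks of α together with {k}. Then |Π_n(1/α′)| < |Π_n(σ_k)| and |Π_n(α/k)| < |Π_n(σ_k)| for all n > k. -/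
open Finset

namespace Finpartition

/-- `i` and `j` lie in the same part of `P`. -/
def Rel {S : Finset ℕ} (P : Finpartition S) (i j : ℕ) : Prop :=
  ∃ B ∈ P.parts, i ∈ B ∧ j ∈ B

section Rel

variable {S T : Finset ℕ} {P Q : Finpartition S} {i j l : ℕ}

lemma Rel.left_mem (h : P.Rel i j) : i ∈ S := by
  obtain ⟨B, hB, hi, -⟩ := h
  exact P.le hB hi

lemma Rel.symm (h : P.Rel i j) : P.Rel j i := by
  obtain ⟨B, hB, hi, hj⟩ := h
  exact ⟨B, hB, hj, hi⟩

lemma Rel.right_mem (h : P.Rel i j) : j ∈ S := h.symm.left_mem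

lemma Rel.trans (h : P.Rel i j) (h' : P.Rel j l) : P.Rel i l := by
  obtain ⟨B, hB, hi, hj⟩ := h
  obtain ⟨C, hC, hj', hl⟩ := h'
  obtain rfl := P.eq_of_mem_parts hB hC hj hj'
  exact ⟨B, hB, hi, hl⟩

lemma rel_refl (P : Finpartition S) (hi : i ∈ S) : P.Rel i i := by
  obtain ⟨B, hB, hi⟩ := P.exists_mem hi
  exact ⟨B, hB, hi, hi⟩

lemma parts_subset_of_rel_iff (h : ∀ i ∈ S, ∀ j ∈ S, P.Rel i j ↔ Q.Rel i j) :
    P.parts ⊆ Q.parts := by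
  intro B hB
  obtain ⟨x, hx⟩ := P.nonempty_of_mem_parts hB
  obtain ⟨C, hC, hxC⟩ := Q.exists_mem (P.le hB hx)
  suffices B = C from this ▸ hC
  ext y
  constructor
  · intro hy
    obtain ⟨D, hD, hxD, hyD⟩ := (h x (P.le hB hx) y (P.le hB hy)).1 ⟨B, hB, hx, hy⟩
    rwa [Q.eq_of_mem_parts hC hD hxC hxD]
  · intro hy
    obtain ⟨D, hD, hxD, hyD⟩ := (h x (P.le hB hx) y (Q.le hC hy)).2 ⟨C, hC, hxC, hy⟩
    rwa [P.eq_of_mem_parts hB hD hx hxD]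

lemma ext_rel (h : ∀ i ∈ S, ∀ j ∈ S, P.Rel i j ↔ Q.Rel i j) : P = Q :=
  Finpartition.ext <| (parts_subset_of_rel_iff h).antisymm <|
    parts_subset_of_rel_iff fun i hi j hj => (h i hi j hj).symm

open Classical in
/-- The partition of `S` into the classes of an equivalence relation. -/
noncomputable def ofEquivalence (S : Finset ℕ) (r : Setoid ℕ) : Finpartition S :=
  ofExistsUnique (S.image fun x => S.filter (r x))
    (by simp only [Finset.mem_image]; rintro _ ⟨x, -, rfl⟩; exact Finset.filter_subset _ _)
    (by
      intro a ha
      refine ⟨S.filter (r a),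
        ⟨Finset.mem_image_of_mem _ ha, Finset.mem_filter.2 ⟨ha, r.refl a⟩⟩, ?_⟩
      rintro t ⟨ht, hat⟩
      obtain ⟨x, -, rfl⟩ := Finset.mem_image.1 ht
      have hxa := (Finset.mem_filter.1 hat).2
      ext y
      simp only [Finset.mem_filter, and_congr_right_iff]
      exact fun _ => ⟨fun h => r.trans (r.symm hxa) h, fun h => r.trans hxa h⟩)
    (by
      intro h
      obtain ⟨x, hx, h⟩ := Finset.mem_image.1 h
      have : x ∈ S.filter (r x) := Finset.mem_filter.2 ⟨hx, r.refl x⟩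
      simp [h] at this)

lemma rel_ofEquivalence {r : Setoid ℕ} :
    (ofEquivalence S r).Rel i j ↔ i ∈ S ∧ j ∈ S ∧ r i j := by
  classical
  simp only [Rel, ofEquivalence, ofExistsUnique, Finset.mem_image, exists_exists_and_eq_and,
    Finset.mem_filter]
  constructor
  · rintro ⟨x, -, ⟨hi, hxi⟩, hj, hxj⟩
    exact ⟨hi, hj, r.trans (r.symm hxi) hxj⟩
  · rintro ⟨hi, hj, h⟩
    exact ⟨i, hi, ⟨hi, r.refl i⟩, hj, h⟩

/-- The equivalence relation on `ℕ` whose classes are the parts of `P` and the singletons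
outside `S`. -/
def toEquivalence (P : Finpartition S) : Setoid ℕ where
  r i j := i = j ∨ P.Rel i j
  iseqv :=
    { refl := fun _ => Or.inl rfl
      symm := by
        rintro i j (rfl | h)
        exacts [Or.inl rfl, Or.inr h.symm]
      trans := by
        rintro i j l (rfl | h) (rfl | h')
        exacts [Or.inl rfl, Or.inr h', Or.inr h, Or.inr (h.trans h')] }

/-- The partition of `T` obtained by pulling `P` back along `g`. -/
noncomputable def comap (T : Finset ℕ) (g : ℕ → ℕ) (P : Finpartition S) : Finpartition T :=
  ofEquivalence T (P.toEquivalence.comap g)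

lemma rel_comap {g : ℕ → ℕ} (hg : ∀ i ∈ T, g i ∈ S) (hi : i ∈ T) (hj : j ∈ T) :
    (P.comap T g).Rel i j ↔ P.Rel (g i) (g j) := by
  rw [comap, rel_ofEquivalence]
  refine ⟨?_, fun h => ⟨hi, hj, Or.inr h⟩⟩
  rintro ⟨-, -, h | h⟩
  · exact h ▸ P.rel_refl (hg i hi)
  · exact h

/-- The partition of `S` with `S \ T` as a part and the remaining parts given by `Q`. -/
noncomputable def extendCompl (S : Finset ℕ) (Q : Finpartition T) : Finpartition S :=
  ofEquivalence S
    { r := fun i j => (i ∉ T ∧ j ∉ T) ∨ Q.Rel i j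
      iseqv :=
        { refl := fun i => by
            by_cases hi : i ∈ T
            exacts [Or.inr (Q.rel_refl hi), Or.inl ⟨hi, hi⟩]
          symm := by
            rintro i j (h | h)
            exacts [Or.inl h.symm, Or.inr h.symm]
          trans := by
            rintro i j l (h | h) (h' | h')
            exacts [Or.inl ⟨h.1, h'.2⟩, absurd h'.left_mem h.2, absurd h.right_mem h'.1,
              Or.inr (h.trans h')] } }

lemma rel_extendCompl {Q : Finpartition T} :
    (Q.extendCompl S).Rel i j ↔ i ∈ S ∧ j ∈ S ∧ ((i ∉ T ∧ j ∉ T) ∨ Q.Rel i j) :=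
  rel_ofEquivalence

open Classical in
/-- The part of `P` containing `a`. -/
noncomputable def blockOf (P : Finpartition S) (a : ℕ) : Finset ℕ := S.filter (P.Rel a)

lemma mem_blockOf : i ∈ P.blockOf j ↔ P.Rel j i := by
  simpa [blockOf] using fun h : P.Rel j i => h.right_mem

/-- Klazar containment of a pattern in a partition of an arbitrary finite set. -/
def HasPattern {k : ℕ} (τ : Finpartition (Idx k)) (P : Finpartition S) : Prop :=
  ∃ f : ℕ → ℕ, StrictMonoOn f (Idx k) ∧ (∀ i ∈ Idx k, f i ∈ S) ∧
    ∀ i ∈ Idx k, ∀ j ∈ Idx k, (τ.Rel i j ↔ P.Rel (f i) (f j))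

/-- The number of partitions of `S` avoiding the pattern `τ`. -/
noncomputable def avoidCountOn (S : Finset ℕ) {k : ℕ} (τ : Finpartition (Idx k)) : ℕ :=
  Nat.card {P : Finpartition S // ¬ HasPattern τ P}

lemma avoidCountOn_le_of_surjOn {k : ℕ} (τ : Finpartition (Idx k)) {g : ℕ → ℕ}
    (hg : StrictMonoOn g T) (hm : ∀ i ∈ T, g i ∈ S) (hs : Set.SurjOn g T S) :
    avoidCountOn S τ ≤ avoidCountOn T τ := by
  refine Nat.card_le_card_of_injective
    (fun P => ⟨P.1.comap T g, fun ⟨f, hf, hfm, hfr⟩ => P.2 ⟨g ∘ f, ?_, ?_, ?_⟩⟩) ?_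
  · exact hg.comp hf hfm
  · exact fun i hi => hm _ (hfm i hi)
  · exact fun i hi j hj => (hfr i hi j hj).trans (rel_comap hm (hfm i hi) (hfm j hj))
  · rintro ⟨P, hP⟩ ⟨Q, hQ⟩ h
    refine Subtype.ext (ext_rel fun i hi j hj => ?_)
    obtain ⟨x, hx, rfl⟩ := hs hi
    obtain ⟨y, hy, rfl⟩ := hs hj
    have h' : P.comap T g = Q.comap T g := congrArg Subtype.val h
    rw [← rel_comap hm hx hy, h', rel_comap hm hx hy]

lemma avoidCountOn_eq_card {k : ℕ} (τ : Finpartition (Idx k)) (T : Finset ℕ) :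
    avoidCountOn T τ = avoidCountOn (Idx T.card) τ := by
  let h : ℕ → ℕ := fun x => (T.filter (· ≤ x)).card
  have hmono : StrictMonoOn h T := by
    intro x hx y hy hxy
    refine Finset.card_lt_card (Finset.ssubset_iff_subset_ne.2 ⟨fun z hz => ?_, fun he => ?_⟩)
    · simp only [Finset.mem_filter] at hz ⊢
      exact ⟨hz.1, hz.2.trans hxy.le⟩
    · have : y ∈ T.filter (· ≤ x) := he ▸ Finset.mem_filter.2 ⟨hy, le_rfl⟩
      exact absurd (Finset.mem_filter.1 this).2 (not_le.2 hxy)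
  have hmaps : ∀ i ∈ T, h i ∈ Idx T.card := fun i hi =>
    Finset.mem_Icc.2 ⟨Finset.card_pos.2 ⟨i, Finset.mem_filter.2 ⟨hi, le_rfl⟩⟩,
      Finset.card_filter_le _ _⟩
  have hsurj : Set.SurjOn h T (Idx T.card) :=
    Finset.surjOn_of_injOn_of_card_le h hmaps hmono.injOn (by simp [Idx])
  have hright : Set.RightInvOn (Function.invFunOn h T) h (Idx T.card) := hsurj.rightInvOn_invFunOn
  have hmaps' : ∀ i ∈ Idx T.card, Function.invFunOn h T i ∈ T := fun i hi =>
    hsurj.mapsTo_invFunOn hi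
  refine le_antisymm (avoidCountOn_le_of_surjOn τ (g := Function.invFunOn h T) ?_ hmaps' ?_)
    (avoidCountOn_le_of_surjOn τ hmono hmaps hsurj)
  · intro x hx y hy hxy
    rw [← hmono.lt_iff_lt (hmaps' x hx) (hmaps' y hy), hright hx, hright hy]
    exact hxy
  · intro x hx
    exact ⟨h x, hmaps x hx, hmono.injOn.leftInvOn_invFunOn hx⟩

lemma avoidCountOn_eq_sum {k : ℕ} (τ : Finpartition (Idx k)) {a : ℕ} (ha : a ∈ S) :
    avoidCountOn S τ = ∑ B ∈ S.powerset with a ∈ B,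
      Nat.card {P : Finpartition S // ¬ HasPattern τ P ∧ P.blockOf a = B} := by
  classical
  simp only [avoidCountOn, Nat.card_eq_fintype_card, Fintype.card_subtype]
  rw [Finset.card_eq_sum_card_fiberwise (f := fun P => P.blockOf a)
    (t := S.powerset.filter (a ∈ ·))]
  · simp only [Finset.filter_filter]
  · intro P _
    simp only [Finset.coe_filter, Finset.mem_powerset, Set.mem_ofPred_eq]
    exact ⟨Finset.filter_subset _ _, mem_blockOf.2 (P.rel_refl ha)⟩

lemma card_fiber_le {k l : ℕ} {τ : Finpartition (Idx k)} {α : Finpartition (Idx l)} {a : ℕ}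
    (H : ∀ P : Finpartition S, HasPattern α (P.comap (S \ P.blockOf a) id) → HasPattern τ P)
    (B : Finset ℕ) :
    Nat.card {P : Finpartition S // ¬ HasPattern τ P ∧ P.blockOf a = B} ≤
      avoidCountOn (S \ B) α := by
  refine Nat.card_le_card_of_injective
    (fun P => ⟨P.1.comap (S \ B) id, fun h => P.2.1 (H _ (by rwa [P.2.2]))⟩) ?_
  rintro ⟨P, hP, hPB⟩ ⟨Q, hQ, hQB⟩ h
  have h' : P.comap (S \ B) id = Q.comap (S \ B) id := congrArg Subtype.val h
  have hm : ∀ i ∈ S \ B, id i ∈ S := fun i hi => (Finset.mem_sdiff.1 hi).1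
  have hP' : ∀ i, P.Rel a i ↔ i ∈ B := fun i => by rw [← hPB, mem_blockOf]
  have hQ' : ∀ i, Q.Rel a i ↔ i ∈ B := fun i => by rw [← hQB, mem_blockOf]
  have key : ∀ R : Finpartition S, (∀ i, R.Rel a i ↔ i ∈ B) → ∀ i, i ∈ B → ∀ j,
      (R.Rel i j ↔ j ∈ B) := fun R hR i hi j =>
    ⟨fun hij => (hR j).1 (((hR i).2 hi).trans hij),
      fun hj => ((hR i).2 hi).symm.trans ((hR j).2 hj)⟩
  have comm : ∀ R : Finpartition S, ∀ i j, R.Rel i j ↔ R.Rel j i := fun R i j =>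
    ⟨Rel.symm, Rel.symm⟩
  refine Subtype.ext (ext_rel fun i hi j hj => ?_)
  by_cases hiB : i ∈ B
  · exact (key P hP' i hiB j).trans (key Q hQ' i hiB j).symm
  by_cases hjB : j ∈ B
  · rw [comm P, comm Q]
    exact (key P hP' j hjB i).trans (key Q hQ' j hjB i).symm
  have hi' := Finset.mem_sdiff.2 ⟨hi, hiB⟩
  have hj' := Finset.mem_sdiff.2 ⟨hj, hjB⟩
  have h1 := rel_comap (P := P) hm hi' hj'
  rw [h', rel_comap hm hi' hj'] at h1
  exact h1.symm

end Rel

variable {S : Finset ℕ} {k : ℕ}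

lemma hasPattern_singletons_of_extendCompl {σ : Finpartition (Idx (k + 1))}
    {σ' : Finpartition (Idx k)}
    (hσ : ∀ i ∈ Idx (k + 1), ∀ j ∈ Idx (k + 1), σ.Rel i j ↔ i = j)
    (hσ' : ∀ i ∈ Idx k, ∀ j ∈ Idx k, σ'.Rel i j ↔ i = j)
    {T : Finset ℕ} {Q : Finpartition T} (h : HasPattern σ (Q.extendCompl S)) :
    HasPattern σ' Q := by
  obtain ⟨f, hf, hfm, hfr⟩ := h
  obtain ⟨c, hc, hcT⟩ : ∃ c ∈ Idx (k + 1), ∀ i ∈ Idx (k + 1), i ≠ c → f i ∈ T := by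
    by_cases hex : ∃ c ∈ Idx (k + 1), f c ∉ T
    · obtain ⟨c, hc, hcT⟩ := hex
      refine ⟨c, hc, fun i hi hic => ?_⟩
      by_contra hiT
      exact hic ((hσ i hi c hc).1 ((hfr i hi c hc).2
        (rel_extendCompl.2 ⟨hfm i hi, hfm c hc, Or.inl ⟨hiT, hcT⟩⟩)))
    · push Not at hex
      exact ⟨k + 1, Finset.mem_Icc.2 (by omega), fun i hi _ => hex i hi⟩
  let e : ℕ → ℕ := fun i => if i < c then i else i + 1
  have he : StrictMono e := by
    intro i j hij
    simp only [e]
    split_ifs <;> omega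
  have hem : ∀ i ∈ Idx k, e i ∈ Idx (k + 1) := by
    intro i hi
    simp only [Idx, Finset.mem_Icc, e] at hi ⊢
    split_ifs <;> omega
  have hec : ∀ i, e i ≠ c := by
    intro i
    simp only [e]
    split_ifs <;> omega
  have hT : ∀ i ∈ Idx k, f (e i) ∈ T := fun i hi => hcT _ (hem i hi) (hec i)
  refine ⟨f ∘ e, hf.comp (he.strictMonoOn _) hem, hT, fun i hi j hj => ?_⟩
  rw [hσ' i hi j hj, ← he.injective.eq_iff, ← hσ _ (hem i hi) _ (hem j hj),
    hfr _ (hem i hi) _ (hem j hj), rel_extendCompl]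
  exact ⟨fun h => h.2.2.resolve_left fun h' => h'.1 (hT i hi),
    fun h => ⟨hfm _ (hem i hi), hfm _ (hem j hj), Or.inr h⟩⟩

lemma le_card_fiber {σ : Finpartition (Idx (k + 1))} {σ' : Finpartition (Idx k)}
    (hσ : ∀ i ∈ Idx (k + 1), ∀ j ∈ Idx (k + 1), σ.Rel i j ↔ i = j)
    (hσ' : ∀ i ∈ Idx k, ∀ j ∈ Idx k, σ'.Rel i j ↔ i = j)
    {a : ℕ} {B : Finset ℕ} (hB : B ⊆ S) (ha : a ∈ B) :
    avoidCountOn (S \ B) σ' ≤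
      Nat.card {P : Finpartition S // ¬ HasPattern σ P ∧ P.blockOf a = B} := by
  refine Nat.card_le_card_of_injective (fun Q => ⟨Q.1.extendCompl S,
    fun h => Q.2 (hasPattern_singletons_of_extendCompl hσ hσ' h), ?_⟩) ?_
  · ext j
    rw [mem_blockOf, rel_extendCompl]
    have haT : a ∉ S \ B := fun h => (Finset.mem_sdiff.1 h).2 ha
    constructor
    · rintro ⟨-, hj, h | h⟩
      · by_contra hjB
        exact h.2 (Finset.mem_sdiff.2 ⟨hj, hjB⟩)
      · exact absurd h.left_mem haT
    · exact fun hj => ⟨hB ha, hB hj, Or.inl ⟨haT, fun h => (Finset.mem_sdiff.1 h).2 hj⟩⟩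
  · rintro ⟨P, hP⟩ ⟨Q, hQ⟩ h
    have h' : P.extendCompl S = Q.extendCompl S := congrArg Subtype.val h
    have key : ∀ R : Finpartition (S \ B), ∀ i ∈ S \ B, ∀ j ∈ S \ B,
        (R.Rel i j ↔ (R.extendCompl S).Rel i j) := by
      intro R i hi j hj
      rw [rel_extendCompl]
      exact ⟨fun h => ⟨(Finset.mem_sdiff.1 hi).1, (Finset.mem_sdiff.1 hj).1, Or.inr h⟩,
        fun h => h.2.2.resolve_left fun h' => h'.1 hi⟩
    refine Subtype.ext (ext_rel fun i hi j hj => ?_)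
    rw [key P i hi j hj, h', ← key Q i hi j hj]

lemma add_sub_le_of_strictMonoOn {f : ℕ → ℕ} (hf : StrictMonoOn f (Idx k)) {i j : ℕ}
    (hi : 1 ≤ i) (hij : i ≤ j) (hj : j ≤ k) : f i + (j - i) ≤ f j := by
  induction j, hij using Nat.le_induction with
  | base => simp
  | succ j hij ih =>
    have h1 := ih (by omega)
    have h2 : f j < f (j + 1) :=
      hf (Finset.mem_coe.2 (Finset.mem_Icc.2 (by omega)))
        (Finset.mem_coe.2 (Finset.mem_Icc.2 (by omega))) (Nat.lt_succ_self j)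
    omega

lemma not_hasPattern_of_lt {m : ℕ} (hm : m < k) (τ : Finpartition (Idx k))
    (P : Finpartition (Idx m)) : ¬ HasPattern τ P := by
  rintro ⟨f, hf, hfm, -⟩
  have h := add_sub_le_of_strictMonoOn hf le_rfl (show 1 ≤ k by omega) le_rfl
  have h1 := Finset.mem_Icc.1 (hfm 1 (Finset.mem_Icc.2 (by omega)))
  have h2 := Finset.mem_Icc.1 (hfm k (Finset.mem_Icc.2 (by omega)))
  omega

lemma hasPattern_iff_eq {τ P : Finpartition (Idx k)} : HasPattern τ P ↔ P = τ := by
  constructor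
  · rintro ⟨f, hf, hfm, hfr⟩
    have hid : ∀ i ∈ Idx k, f i = i := by
      intro i hi
      have hi' := Finset.mem_Icc.1 hi
      have h1 := Finset.mem_Icc.1 (hfm 1 (Finset.mem_Icc.2 (by omega)))
      have h2 := Finset.mem_Icc.1 (hfm k (Finset.mem_Icc.2 (by omega)))
      have h3 := add_sub_le_of_strictMonoOn hf le_rfl hi'.1 hi'.2
      have h4 := add_sub_le_of_strictMonoOn hf hi'.1 hi'.2 le_rfl
      omega
    refine ext_rel fun i hi j hj => ?_
    rw [hfr i hi j hj, hid i hi, hid j hj]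
  · rintro rfl
    exact ⟨id, strictMono_id.strictMonoOn _, fun i hi => hi, fun _ _ _ _ => Iff.rfl⟩

lemma avoidCountOn_eq_of_le {m : ℕ} (hm : m ≤ k) (τ τ' : Finpartition (Idx k)) :
    avoidCountOn (Idx m) τ = avoidCountOn (Idx m) τ' := by
  classical
  rcases hm.lt_or_eq with hm | rfl
  · simp only [avoidCountOn, not_hasPattern_of_lt hm]
  · simp only [avoidCountOn, hasPattern_iff_eq, Nat.card_eq_fintype_card,
      Fintype.card_subtype_compl, Fintype.card_subtype_eq]

lemma avoidCountOn_lt {α σ' : Finpartition (Idx k)} {τ σ : Finpartition (Idx (k + 1))}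
    (hσ : ∀ i ∈ Idx (k + 1), ∀ j ∈ Idx (k + 1), σ.Rel i j ↔ i = j)
    (hσ' : ∀ i ∈ Idx k, ∀ j ∈ Idx k, σ'.Rel i j ↔ i = j)
    (hα : ∀ m, k < m → avoidCountOn (Idx m) α < avoidCountOn (Idx m) σ')
    {a : ℕ} (ha : a ∈ S) (hS : k + 1 < S.card)
    (H : ∀ P : Finpartition S, HasPattern α (P.comap (S \ P.blockOf a) id) → HasPattern τ P) :
    avoidCountOn S τ < avoidCountOn S σ := by
  rw [avoidCountOn_eq_sum τ ha, avoidCountOn_eq_sum σ ha]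
  refine Finset.sum_lt_sum (fun B hB => ?_) ⟨{a}, ?_, ?_⟩
  · obtain ⟨hBS, haB⟩ := Finset.mem_filter.1 hB
    refine (card_fiber_le H B).trans (le_trans ?_
      (le_card_fiber hσ hσ' (Finset.mem_powerset.1 hBS) haB))
    rw [avoidCountOn_eq_card α, avoidCountOn_eq_card σ']
    rcases le_or_gt (S \ B).card k with h | h
    · exact (avoidCountOn_eq_of_le h α σ').le
    · exact (hα _ h).le
  · simpa using ha
  · refine (card_fiber_le H {a}).trans_lt (lt_of_lt_of_le ?_
      (le_card_fiber hσ hσ' (Finset.singleton_subset_iff.2 ha) (Finset.mem_singleton_self a)))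
    rw [avoidCountOn_eq_card α, avoidCountOn_eq_card σ']
    refine hα _ ?_
    rw [Finset.card_sdiff_of_subset (Finset.singleton_subset_iff.2 ha), Finset.card_singleton]
    omega

lemma rel_iff_eq_of_parts_eq {σ : Finpartition S} (hσ : σ.parts = S.image fun x => {x}) :
    ∀ i ∈ S, ∀ j ∈ S, σ.Rel i j ↔ i = j := by
  intro i hi j _
  simp only [Rel, hσ, Finset.mem_image, exists_exists_and_eq_and, Finset.mem_singleton]
  constructor
  · rintro ⟨x, -, rfl, rfl⟩
    rfl
  · rintro rfl
    exact ⟨i, hi, rfl, rfl⟩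

section Extension

variable {α : Finpartition (Idx k)} {τ : Finpartition (Idx (k + 1))} {n : ℕ}

lemma hasPattern_singleton_bot
    (hτ : τ.parts = insert {1} (α.parts.image fun B => B.image (· + 1))) (hn : 1 ≤ n)
    (P : Finpartition (Idx n)) (h : HasPattern α (P.comap (Idx n \ P.blockOf 1) id)) :
    HasPattern τ P := by
  obtain ⟨f, hf, hfm, hfr⟩ := h
  have hm : ∀ i ∈ Idx n \ P.blockOf 1, id i ∈ Idx n := fun i hi => (Finset.mem_sdiff.1 hi).1
  have h1n : 1 ∈ Idx n := Finset.mem_Icc.2 ⟨le_rfl, hn⟩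
  have hnot : ∀ i ∈ Idx k, ¬ P.Rel 1 (f i) := fun i hi h =>
    (Finset.mem_sdiff.1 (hfm i hi)).2 (mem_blockOf.2 h)
  have hlt : ∀ i ∈ Idx k, 1 < f i := by
    intro i hi
    have h1 := Finset.mem_Icc.1 (hm _ (hfm i hi))
    refine lt_of_le_of_ne h1.1 fun he => hnot i hi ?_
    rw [← he]
    exact P.rel_refl h1n
  have hα0 : ∀ i, ¬ α.Rel 0 i := fun i h => by simpa [Idx] using h.left_mem
  have hτr : ∀ i j, τ.Rel (i + 1) (j + 1) ↔ (i = 0 ∧ j = 0) ∨ α.Rel i j := by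
    intro i j
    simp [Rel, hτ]
  have hcases : ∀ i ∈ Idx (k + 1), i = 1 ∨ ∃ i' ∈ Idx k, i = i' + 1 := by
    intro i hi
    have := Finset.mem_Icc.1 hi
    by_cases h : i = 1
    · exact Or.inl h
    · exact Or.inr ⟨i - 1, Finset.mem_Icc.2 (by omega), by omega⟩
  let g : ℕ → ℕ := fun i => if i = 1 then 1 else f (i - 1)
  have g1 : g 1 = 1 := rfl
  have gs : ∀ i ∈ Idx k, g (i + 1) = f i := by
    intro i hi
    have := Finset.mem_Icc.1 hi
    simp only [g, Nat.add_sub_cancel]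
    rw [if_neg (by omega)]
  refine ⟨g, ?_, ?_, ?_⟩
  · intro i hi' j hj' hij
    rcases hcases _ hi' with rfl | ⟨i, hi, rfl⟩ <;> rcases hcases _ hj' with rfl | ⟨j, hj, rfl⟩
    · omega
    · rw [g1, gs j hj]
      exact hlt j hj
    · omega
    · rw [gs i hi, gs j hj]
      exact hf hi hj (by omega)
  · intro i hi'
    rcases hcases _ hi' with rfl | ⟨i, hi, rfl⟩
    · exact h1n
    · rw [gs i hi]
      exact hm _ (hfm i hi)
  · intro i hi' j hj'
    rcases hcases _ hi' with rfl | ⟨i, hi, rfl⟩ <;> rcases hcases _ hj' with rfl | ⟨j, hj, rfl⟩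
    · exact iff_of_true ((hτr 0 0).2 (Or.inl ⟨rfl, rfl⟩)) (P.rel_refl h1n)
    · rw [g1, gs j hj]
      have := Finset.mem_Icc.1 hj
      refine iff_of_false (fun h => ?_) (hnot j hj)
      rcases (hτr 0 j).1 h with h | h
      · omega
      · exact hα0 _ h
    · rw [g1, gs i hi]
      have := Finset.mem_Icc.1 hi
      refine iff_of_false (fun h => ?_) fun h => hnot i hi h.symm
      rcases (hτr i 0).1 h with h | h
      · omega
      · exact hα0 _ h.symm
    · rw [gs i hi, gs j hj, hτr, hfr i hi j hj, rel_comap hm (hfm i hi) (hfm j hj)]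
      have := Finset.mem_Icc.1 hi
      exact or_iff_right fun h => by omega

lemma hasPattern_singleton_top (hτ : τ.parts = insert {k + 1} α.parts) (hn : 1 ≤ n)
    (P : Finpartition (Idx n)) (h : HasPattern α (P.comap (Idx n \ P.blockOf n) id)) :
    HasPattern τ P := by
  obtain ⟨f, hf, hfm, hfr⟩ := h
  have hm : ∀ i ∈ Idx n \ P.blockOf n, id i ∈ Idx n := fun i hi => (Finset.mem_sdiff.1 hi).1
  have hnn : n ∈ Idx n := Finset.mem_Icc.2 ⟨hn, le_rfl⟩
  have hnot : ∀ i ∈ Idx k, ¬ P.Rel n (f i) := fun i hi h =>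
    (Finset.mem_sdiff.1 (hfm i hi)).2 (mem_blockOf.2 h)
  have hlt : ∀ i ∈ Idx k, f i < n := by
    intro i hi
    have h1 := Finset.mem_Icc.1 (hm _ (hfm i hi))
    refine lt_of_le_of_ne h1.2 fun he => hnot i hi ?_
    rw [he]
    exact P.rel_refl hnn
  have hαk : ∀ i, ¬ α.Rel (k + 1) i := fun i h => by simpa [Idx] using h.left_mem
  have hτr : ∀ i j, τ.Rel i j ↔ (i = k + 1 ∧ j = k + 1) ∨ α.Rel i j := by
    intro i j
    simp [Rel, hτ]
  have hcases : ∀ i ∈ Idx (k + 1), i = k + 1 ∨ i ∈ Idx k := by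
    intro i hi
    have := Finset.mem_Icc.1 hi
    by_cases h : i = k + 1
    · exact Or.inl h
    · exact Or.inr (Finset.mem_Icc.2 (by omega))
  let g : ℕ → ℕ := fun i => if i = k + 1 then n else f i
  have gk : g (k + 1) = n := if_pos rfl
  have gs : ∀ i ∈ Idx k, g i = f i := by
    intro i hi
    have := Finset.mem_Icc.1 hi
    exact if_neg (by omega)
  refine ⟨g, ?_, ?_, ?_⟩
  · intro i hi j hj hij
    rcases hcases i hi with rfl | hi <;> rcases hcases j hj with rfl | hj
    · omega
    · have := Finset.mem_Icc.1 hj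
      omega
    · rw [gk, gs i hi]
      exact hlt i hi
    · rw [gs i hi, gs j hj]
      exact hf hi hj hij
  · intro i hi
    rcases hcases i hi with rfl | hi
    · rwa [gk]
    · rw [gs i hi]
      exact hm _ (hfm i hi)
  · intro i hi j hj
    rcases hcases i hi with rfl | hi <;> rcases hcases j hj with rfl | hj
    · rw [gk]
      exact iff_of_true ((hτr _ _).2 (Or.inl ⟨rfl, rfl⟩)) (P.rel_refl hnn)
    · rw [gk, gs j hj]
      have := Finset.mem_Icc.1 hj
      refine iff_of_false (fun h => ?_) (hnot j hj)
      rcases (hτr _ j).1 h with h | h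
      · omega
      · exact hαk _ h
    · rw [gk, gs i hi]
      have := Finset.mem_Icc.1 hi
      refine iff_of_false (fun h => ?_) fun h => hnot i hi h.symm
      rcases (hτr i _).1 h with h | h
      · omega
      · exact hαk _ h.symm
    · rw [gs i hi, gs j hj, hτr, hfr i hi j hj, rel_comap hm (hfm i hi) (hfm j hj)]
      have := Finset.mem_Icc.1 hi
      exact or_iff_right fun h => by omega

end Extension

end Finpartition

/-- If `|Π_n(α)| < |Π_n(σ_{k-1})|` for all `n > k - 1`, then both
`|Π_n(1/α')| < |Π_n(σ_k)|` and `|Π_n(α/k)| < |Π_n(σ_k)|` for all `n > k`. -/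
theorem avoidCount_induction_lemma (k : ℕ) (hk : 2 ≤ k)
    (α σk1 : Finpartition (Idx (k - 1)))
    (hσk1 : σk1.parts = (Idx (k - 1)).image (fun x => {x}))
    (hα : ∀ n : ℕ, k - 1 < n → avoidCount n α < avoidCount n σk1)
    (τ1 τ2 σk : Finpartition (Idx k))
    (hτ1 : τ1.parts = insert {1} (α.parts.image (fun B => B.image (· + 1))))
    (hτ2 : τ2.parts = insert {k} α.parts)
    (hσk : σk.parts = (Idx k).image (fun x => {x})) :
    ∀ n : ℕ, k < n →
      avoidCount n τ1 < avoidCount n σk ∧ avoidCount n τ2 < avoidCount n σk := by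
  obtain ⟨k, rfl⟩ := Nat.exists_eq_add_of_le' (show 1 ≤ k by omega)
  intro n hn
  have hcard : k + 1 < (Idx n).card := by simpa [Idx] using hn
  have hσ := Finpartition.rel_iff_eq_of_parts_eq hσk
  have hσ' := Finpartition.rel_iff_eq_of_parts_eq hσk1
  have h1n : 1 ≤ n := by omega
  exact ⟨Finpartition.avoidCountOn_lt hσ hσ' hα (Finset.mem_Icc.2 ⟨le_rfl, h1n⟩) hcard
      (Finpartition.hasPattern_singleton_bot hτ1 h1n),
    Finpartition.avoidCountOn_lt hσ hσ' hα (Finset.mem_Icc.2 ⟨h1n, le_rfl⟩) hcard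
      (Finpartition.hasPattern_singleton_top hτ2 h1n)⟩
end

section
/- For all k ≥ 2 and n ≥ 1, |Π_n(σ_k)| ≤ |Π_n(β_k)|, where σ_k is the set partition of [k] all of whose blocks are singletons and β_k is the set partition of [k] with the single block [k]. Moreover, this inequality is strict whenever n > k > 2. -/
open Finset

/-- `F` is the family of blocks of a set partition of `s`. -/
structure IsBlocks (s : Finset ℕ) (F : Finset (Finset ℕ)) : Prop where
  nonempty : ∀ B ∈ F, B.Nonempty
  eq_of_mem : ∀ B ∈ F, ∀ C ∈ F, ∀ x ∈ B, x ∈ C → B = C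
  mem_iff : ∀ x, x ∈ s ↔ ∃ B ∈ F, x ∈ B

namespace IsBlocks

variable {s t : Finset ℕ} {F G : Finset (Finset ℕ)}

lemma subset (h : IsBlocks s F) {B : Finset ℕ} (hB : B ∈ F) : B ⊆ s :=
  fun x hx => (h.mem_iff x).2 ⟨B, hB, hx⟩

lemma singleton (hs : s.Nonempty) : IsBlocks s {s} :=
  ⟨by simpa using hs, by simp, by simp⟩

lemma union (hF : IsBlocks s F) (hG : IsBlocks t G) (hst : Disjoint s t) :
    IsBlocks (s ∪ t) (F ∪ G) := by
  have hd : ∀ x ∈ s, x ∉ t := fun x hx hx' => Finset.disjoint_left.1 hst hx hx'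
  refine ⟨?_, ?_, ?_⟩
  · intro B hB
    rcases Finset.mem_union.1 hB with hB | hB
    exacts [hF.nonempty B hB, hG.nonempty B hB]
  · intro B hB C hC x hxB hxC
    rcases Finset.mem_union.1 hB with hB | hB <;> rcases Finset.mem_union.1 hC with hC | hC
    · exact hF.eq_of_mem B hB C hC x hxB hxC
    · exact absurd (hG.subset hC hxC) (hd x (hF.subset hB hxB))
    · exact absurd (hG.subset hB hxB) (hd x (hF.subset hC hxC))
    · exact hG.eq_of_mem B hB C hC x hxB hxC
  · intro x
    rw [Finset.mem_union, hF.mem_iff, hG.mem_iff]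
    simp only [Finset.mem_union, or_and_right, exists_or]

lemma filter_subset_union (hF : IsBlocks s F) (hG : IsBlocks t G) (hst : Disjoint s t) :
    (F ∪ G).filter (· ⊆ s) = F := by
  ext B
  rw [Finset.mem_filter, Finset.mem_union]
  refine ⟨?_, fun h => ⟨Or.inl h, hF.subset h⟩⟩
  rintro ⟨h | h, hB⟩
  · exact h
  · obtain ⟨x, hx⟩ := hG.nonempty B h
    exact absurd (hG.subset h hx) (Finset.disjoint_left.1 hst (hB hx))

lemma erase (hF : IsBlocks s F) {B : Finset ℕ} (hB : B ∈ F) : IsBlocks (s \ B) (F.erase B) := by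
  refine ⟨fun C hC => hF.nonempty C (Finset.mem_of_mem_erase hC), fun C hC D hD =>
    hF.eq_of_mem C (Finset.mem_of_mem_erase hC) D (Finset.mem_of_mem_erase hD), fun x => ?_⟩
  rw [Finset.mem_sdiff, hF.mem_iff]
  constructor
  · rintro ⟨⟨C, hC, hx⟩, hxB⟩
    exact ⟨C, Finset.mem_erase.2 ⟨fun h => hxB (h ▸ hx), hC⟩, hx⟩
  · rintro ⟨C, hC, hx⟩
    obtain ⟨hne, hC⟩ := Finset.mem_erase.1 hC
    exact ⟨⟨C, hC, hx⟩, fun hxB => hne (hF.eq_of_mem C hC B hB x hx hxB)⟩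

lemma image_singleton (s : Finset ℕ) : IsBlocks s (s.image fun x => {x}) :=
  ⟨by simp, by simp, by simp⟩

lemma of_finpartition (P : Finpartition s) : IsBlocks s P.parts :=
  ⟨fun _ hB => P.nonempty_of_mem_parts hB,
    fun _ hB _ hC _ hxB hxC => P.eq_of_mem_parts hB hC hxB hxC,
    fun _ => ⟨fun hx => P.exists_mem hx, fun ⟨_, hB, hx⟩ => P.le hB hx⟩⟩

/-- The finpartition with a given family of blocks. -/
def toFinpartition (hF : IsBlocks s F) : Finpartition s :=
  Finpartition.ofExistsUnique F (fun _ hB => hF.subset hB)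
    (fun x hx => by
      obtain ⟨B, hB, hxB⟩ := (hF.mem_iff x).1 hx
      exact ⟨B, ⟨hB, hxB⟩, fun C hC => hF.eq_of_mem C hC.1 B hB x hC.2 hxB⟩)
    (fun h => by simpa using hF.nonempty _ h)

end IsBlocks

/-- The union of the blocks which contain `a` or have exactly `m` elements. -/
def markedUnion (a m : ℕ) (F : Finset (Finset ℕ)) : Finset ℕ :=
  (F.filter fun B => a ∈ B ∨ B.card = m).sup id

lemma mem_markedUnion {a m x : ℕ} {F : Finset (Finset ℕ)} :
    x ∈ markedUnion a m F ↔ ∃ B ∈ F, (a ∈ B ∨ B.card = m) ∧ x ∈ B := by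
  simp [markedUnion, Finset.mem_sup, and_assoc]

/-- A set containing `a` can be cut into a block containing `a` of size at most `m` and blocks
of size exactly `m`. -/
lemma exists_isBlocks_card_eq {m : ℕ} (hm : 0 < m) (a : ℕ) (N : ℕ) :
    ∀ s : Finset ℕ, s.card = N → a ∈ s →
      ∃ F, IsBlocks s F ∧ (∀ B ∈ F, B.card ≤ m) ∧ ∀ B ∈ F, a ∈ B ∨ B.card = m := by
  induction N using Nat.strong_induction_on with
  | _ N ih =>
  intro s hs ha
  by_cases hsm : s.card ≤ m
  · exact ⟨{s}, IsBlocks.singleton ⟨a, ha⟩, by simpa using hsm, by simp [ha]⟩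
  obtain ⟨T, hT, hTm⟩ := Finset.exists_subset_card_eq
    (show m ≤ (s.erase a).card by rw [Finset.card_erase_of_mem ha]; omega)
  have hTs : T ⊆ s := hT.trans (Finset.erase_subset _ _)
  have haT : a ∉ T := fun h => Finset.notMem_erase a s (hT h)
  have hc := Finset.card_sdiff_of_subset hTs
  obtain ⟨F, hF, hFm, hFa⟩ := ih (s \ T).card (by omega) (s \ T) rfl
    (Finset.mem_sdiff.2 ⟨ha, haT⟩)
  have hTne : T.Nonempty := Finset.card_pos.1 (by omega)
  refine ⟨F ∪ {T}, ?_, ?_, ?_⟩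
  · have := hF.union (IsBlocks.singleton hTne) Finset.sdiff_disjoint
    rwa [Finset.sdiff_union_of_subset hTs] at this
  · intro B hB
    rcases Finset.mem_union.1 hB with hB | hB
    · exact hFm B hB
    · rw [Finset.mem_singleton.1 hB, hTm]
  · intro B hB
    rcases Finset.mem_union.1 hB with hB | hB
    · exact hFa B hB
    · rw [Finset.mem_singleton.1 hB]; exact Or.inr hTm

lemma markedUnion_union {a m : ℕ} {s t : Finset ℕ} {F G : Finset (Finset ℕ)}
    (hF : IsBlocks s F) (hG : IsBlocks t G) (hFa : ∀ B ∈ F, a ∈ B ∨ B.card = m)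
    (hat : a ∉ t) (hGm : ∀ B ∈ G, B.card < m) : markedUnion a m (F ∪ G) = s := by
  ext x
  rw [mem_markedUnion, hF.mem_iff]
  constructor
  · rintro ⟨B, hB, hBm, hx⟩
    rcases Finset.mem_union.1 hB with hB | hB
    · exact ⟨B, hB, hx⟩
    · rcases hBm with h | h
      · exact absurd (hG.subset hB h) hat
      · exact absurd h (hGm B hB).ne
  · rintro ⟨B, hB, hx⟩
    exact ⟨B, Finset.mem_union_left _ hB, hFa B hB, hx⟩

/-- A function on families of blocks which maps the partitions of `s` with at most `m` blocks
injectively to the partitions of `s` into blocks of size at most `m`. -/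
structure IsBlockInjection (s : Finset ℕ) (m : ℕ)
    (φ : Finset (Finset ℕ) → Finset (Finset ℕ)) : Prop where
  isBlocks : ∀ F, IsBlocks s F → F.card ≤ m → IsBlocks s (φ F)
  card_le : ∀ F, IsBlocks s F → F.card ≤ m → ∀ B ∈ φ F, B.card ≤ m
  inj : ∀ F G, IsBlocks s F → F.card ≤ m → IsBlocks s G → G.card ≤ m → φ F = φ G → F = G

/-- Given block injections for `m` blocks, there is one for `m + 1` blocks of a set containing
`a`, whose values `φ F` are determined on `markedUnion a (m + 1) (φ F)` by that union. -/
lemma exists_isBlockInjection_succ {m : ℕ} (ih : ∀ s, ∃ φ, IsBlockInjection s m φ)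
    {s : Finset ℕ} {a : ℕ} (ha : a ∈ s) :
    ∃ φ, IsBlockInjection s (m + 1) φ ∧
      ∃ c : Finset ℕ → Finset (Finset ℕ), ∀ F, IsBlocks s F → F.card ≤ m + 1 →
        (φ F).filter (· ⊆ markedUnion a (m + 1) (φ F)) = c (markedUnion a (m + 1) (φ F)) := by
  choose ψ hψ using ih
  have hex : ∀ S : Finset ℕ, ∃ F, a ∈ S → IsBlocks S F ∧ (∀ B ∈ F, B.card ≤ m + 1) ∧
      ∀ B ∈ F, a ∈ B ∨ B.card = m + 1 := by
    intro S
    by_cases h : a ∈ S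
    · obtain ⟨F, hF⟩ := exists_isBlocks_card_eq m.succ_pos a _ S rfl h
      exact ⟨F, fun _ => hF⟩
    · exact ⟨∅, fun h' => absurd h' h⟩
  choose c hc using hex
  have hblock : ∀ F : Finset (Finset ℕ), ∃ S, IsBlocks s F → S ∈ F ∧ a ∈ S := by
    intro F
    by_cases h : IsBlocks s F
    · obtain ⟨S, hS⟩ := (h.mem_iff a).1 ha
      exact ⟨S, fun _ => hS⟩
    · exact ⟨∅, fun h' => absurd h' h⟩
  choose b hb using hblock
  have hrest : ∀ F, IsBlocks s F → F.card ≤ m + 1 →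
      IsBlocks (s \ b F) (F.erase (b F)) ∧ (F.erase (b F)).card ≤ m := by
    intro F hF hFm
    refine ⟨hF.erase (hb F hF).1, ?_⟩
    rw [Finset.card_erase_of_mem (hb F hF).1]
    omega
  let rest : Finset (Finset ℕ) → Finset (Finset ℕ) := fun F => ψ (s \ b F) (F.erase (b F))
  have hQ : ∀ F, IsBlocks s F → F.card ≤ m + 1 → IsBlocks (s \ b F) (rest F) :=
    fun F hF hFm => (hψ _).isBlocks _ (hrest F hF hFm).1 (hrest F hF hFm).2
  have hQm : ∀ F, IsBlocks s F → F.card ≤ m + 1 → ∀ B ∈ rest F, B.card ≤ m :=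
    fun F hF hFm => (hψ _).card_le _ (hrest F hF hFm).1 (hrest F hF hFm).2
  have hmarked : ∀ F, IsBlocks s F → F.card ≤ m + 1 →
      markedUnion a (m + 1) (c (b F) ∪ rest F) = b F := fun F hF hFm =>
    markedUnion_union (hc _ (hb F hF).2).1 (hQ F hF hFm) (hc _ (hb F hF).2).2.2
      (fun h => (Finset.mem_sdiff.1 h).2 (hb F hF).2)
      (fun B hB => Nat.lt_succ_of_le (hQm F hF hFm B hB))
  refine ⟨fun F => c (b F) ∪ rest F, ⟨?_, ?_, ?_⟩, c, ?_⟩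
  · intro F hF hFm
    have := (hc _ (hb F hF).2).1.union (hQ F hF hFm) Finset.disjoint_sdiff
    rwa [Finset.union_sdiff_of_subset (hF.subset (hb F hF).1)] at this
  · intro F hF hFm B hB
    rcases Finset.mem_union.1 hB with hB | hB
    · exact (hc _ (hb F hF).2).2.1 B hB
    · exact (hQm F hF hFm B hB).trans m.le_succ
  · intro F G hF hFm hG hGm hFG
    have hbb : b F = b G := by
      rw [← hmarked F hF hFm, ← hmarked G hG hGm]
      exact congrArg _ hFG
    have hrestF : (c (b F) ∪ rest F).filter (· ⊆ s \ b F) = rest F := by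
      rw [Finset.union_comm]
      exact (hQ F hF hFm).filter_subset_union (hc _ (hb F hF).2).1 Finset.sdiff_disjoint
    have hrestG : (c (b G) ∪ rest G).filter (· ⊆ s \ b G) = rest G := by
      rw [Finset.union_comm]
      exact (hQ G hG hGm).filter_subset_union (hc _ (hb G hG).2).1 Finset.sdiff_disjoint
    have hrr : rest F = rest G := by
      rw [← hrestF, ← hrestG, ← hbb]
      congr 1
      simpa [hbb] using hFG
    have her : F.erase (b F) = G.erase (b F) := by
      refine (hψ (s \ b F)).inj _ _ (hrest F hF hFm).1 (hrest F hF hFm).2 ?_ ?_ ?_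
      · rw [hbb]; exact (hrest G hG hGm).1
      · rw [hbb]; exact (hrest G hG hGm).2
      · have : ψ (s \ b F) (F.erase (b F)) = ψ (s \ b G) (G.erase (b G)) := hrr
        rwa [← hbb] at this
    rw [← Finset.insert_erase (hb F hF).1, her, hbb, Finset.insert_erase (hb G hG).1]
  · intro F hF hFm
    simp only [hmarked F hF hFm]
    exact (hc _ (hb F hF).2).1.filter_subset_union (hQ F hF hFm) Finset.disjoint_sdiff

lemma exists_isBlockInjection (m : ℕ) : ∀ s, ∃ φ, IsBlockInjection s m φ := by
  induction m with
  | zero =>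
    refine fun s => ⟨id, fun F hF _ => hF, fun F _ hF B hB => ?_, fun F G _ _ _ _ h => h⟩
    simp only [Nat.le_zero, Finset.card_eq_zero] at hF
    simp [hF] at hB
  | succ m ih =>
    intro s
    rcases s.eq_empty_or_nonempty with rfl | ⟨a, ha⟩
    · refine ⟨id, fun F hF _ => hF, fun F hF _ B hB => ?_, fun F G _ _ _ _ h => h⟩
      rw [Finset.subset_empty.1 (hF.subset hB)]
      simp
    · obtain ⟨φ, hφ, -⟩ := exists_isBlockInjection_succ ih ha
      exact ⟨φ, hφ⟩

/-- The partition of `insert a T ∪ R` into `{a, x}`, `T \ {x}` and the singletons of `R`. -/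
lemma isBlocks_pair_and_singletons {a x : ℕ} {T R : Finset ℕ} (hx : x ∈ T) (haT : a ∉ T)
    (hT : 1 < T.card) (hR : Disjoint (insert a T) R) :
    IsBlocks (insert a T ∪ R) (({{a, x}} ∪ {T.erase x}) ∪ R.image fun y => {y}) := by
  refine IsBlocks.union ?_ (IsBlocks.image_singleton R) hR
  have hne : (T.erase x).Nonempty := Finset.card_pos.1 (by
    rw [Finset.card_erase_of_mem hx]; omega)
  have hd : Disjoint {a, x} (T.erase x) := by
    rw [Finset.disjoint_left]
    intro y hy hy'
    obtain ⟨hyx, hyT⟩ := Finset.mem_erase.1 hy'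
    rcases Finset.mem_insert.1 hy with rfl | hy
    · exact haT hyT
    · exact hyx (Finset.mem_singleton.1 hy)
  have := (IsBlocks.singleton (Finset.insert_nonempty a {x})).union (IsBlocks.singleton hne) hd
  convert this using 1
  rw [Finset.insert_union, ← Finset.insert_eq, Finset.insert_erase hx]

lemma exists_isBlockInjection_not_surj {m : ℕ} (hm : 2 ≤ m) {s : Finset ℕ}
    (hs : m + 2 ≤ s.card) :
    ∃ φ, IsBlockInjection s m φ ∧ ∃ G, IsBlocks s G ∧ (∀ B ∈ G, B.card ≤ m) ∧
      ∀ F, IsBlocks s F → F.card ≤ m → φ F ≠ G := by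
  obtain ⟨a, ha⟩ : s.Nonempty := Finset.card_pos.1 (by omega)
  obtain ⟨m, rfl⟩ : ∃ l, m = l + 1 := ⟨m - 1, by omega⟩
  obtain ⟨φ, hφ, c, hc⟩ := exists_isBlockInjection_succ (exists_isBlockInjection m) ha
  obtain ⟨T, hT, hTm⟩ := Finset.exists_subset_card_eq
    (show m + 2 ≤ (s.erase a).card by rw [Finset.card_erase_of_mem ha]; omega)
  have haT : a ∉ T := fun h => Finset.notMem_erase a s (hT h)
  have hTs : insert a T ⊆ s :=
    Finset.insert_subset ha (hT.trans (Finset.erase_subset _ _))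
  obtain ⟨x, hx, y, hy, hxy⟩ := Finset.one_lt_card.1 (show 1 < T.card by omega)
  let R := s \ insert a T
  let G : ℕ → Finset (Finset ℕ) := fun z => ({{a, z}} ∪ {T.erase z}) ∪ R.image fun y => {y}
  have hG : ∀ z ∈ T, IsBlocks s (G z) := by
    intro z hz
    have := isBlocks_pair_and_singletons hz haT (by omega)
      (Finset.disjoint_sdiff (s := insert a T) (t := s))
    rwa [Finset.union_sdiff_of_subset hTs] at this
  have hGm : ∀ z ∈ T, ∀ B ∈ G z, B.card ≤ m + 1 := by
    intro z hz B hB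
    simp only [G, Finset.mem_union, Finset.mem_singleton, Finset.mem_image] at hB
    rcases hB with (rfl | rfl) | ⟨w, -, rfl⟩
    · exact Finset.card_le_two.trans hm
    · rw [Finset.card_erase_of_mem hz]; omega
    · simp
  have hGmarked : ∀ z ∈ T, markedUnion a (m + 1) (G z) = insert a T := by
    intro z hz
    ext w
    rw [mem_markedUnion]
    simp only [G, Finset.mem_union, Finset.mem_singleton, Finset.mem_image]
    constructor
    · rintro ⟨B, (rfl | rfl) | ⟨v, hv, rfl⟩, hB, hw⟩
      · simp only [Finset.mem_insert, Finset.mem_singleton] at hw ⊢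
        rcases hw with rfl | rfl
        exacts [Or.inl rfl, Or.inr hz]
      · exact Finset.mem_insert_of_mem (Finset.mem_of_mem_erase hw)
      · rcases hB with hB | hB
        · rw [Finset.mem_singleton] at hB
          subst hB
          simp [R] at hv
        · simp at hB
          omega
    · intro hw
      by_cases h : w = a ∨ w = z
      · exact ⟨{a, z}, Or.inl (Or.inl rfl), by simp, by simpa using h⟩
      · push Not at h
        refine ⟨T.erase z, Or.inl (Or.inr rfl), Or.inr ?_, ?_⟩
        · rw [Finset.card_erase_of_mem hz]; omega
        · exact Finset.mem_erase.2 ⟨h.2, Finset.mem_of_mem_insert_of_ne hw h.1⟩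
  have hcG : ∀ z ∈ T, ∀ F, IsBlocks s F → F.card ≤ m + 1 → φ F = G z →
      (G z).filter (· ⊆ insert a T) = c (insert a T) := by
    intro z hz F hF hFm h
    have := hc F hF hFm
    rwa [h, hGmarked z hz] at this
  refine ⟨φ, hφ, ?_⟩
  by_contra hcon
  push Not at hcon
  obtain ⟨F₁, hF₁, hFm₁, h₁⟩ := hcon (G x) (hG x hx) (hGm x hx)
  obtain ⟨F₂, hF₂, hFm₂, h₂⟩ := hcon (G y) (hG y hy) (hGm y hy)
  have hfil := (hcG x hx F₁ hF₁ hFm₁ h₁).trans (hcG y hy F₂ hF₂ hFm₂ h₂).symm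
  have hmem : ({a, x} : Finset ℕ) ∈ (G x).filter (· ⊆ insert a T) := by
    rw [Finset.mem_filter]
    refine ⟨by simp [G], ?_⟩
    intro w hw
    simp only [Finset.mem_insert, Finset.mem_singleton] at hw ⊢
    rcases hw with rfl | rfl
    exacts [Or.inl rfl, Or.inr hx]
  rw [hfil] at hmem
  have heq := (hG y hy).eq_of_mem _ (Finset.mem_filter.1 hmem).1 {a, y} (by simp [G]) a
    (by simp) (by simp)
  have : x ∈ ({a, y} : Finset ℕ) := heq ▸ (by simp)
  simp only [Finset.mem_insert, Finset.mem_singleton] at this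
  rcases this with rfl | rfl
  exacts [haT hx, hxy rfl]

lemma exists_strictMonoOn_of_le_card {k : ℕ} {T : Finset ℕ} (hT : k ≤ T.card) :
    ∃ f : ℕ → ℕ, StrictMonoOn f (Idx k) ∧ ∀ i ∈ Idx k, f i ∈ T := by
  obtain ⟨U, hUT, hU⟩ := Finset.exists_subset_card_eq hT
  refine ⟨fun i => if h : i - 1 < k then U.orderEmbOfFin hU ⟨i - 1, h⟩ else 0, ?_, ?_⟩
  · intro i hi j hj hij
    simp only [Idx, Finset.coe_Icc, Set.mem_Icc] at hi hj
    simp only [show i - 1 < k by omega, show j - 1 < k by omega, dite_true]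
    apply (U.orderEmbOfFin hU).strictMono
    rw [Fin.mk_lt_mk]
    omega
  · intro i hi
    simp only [Idx, Finset.mem_Icc] at hi
    simp only [show i - 1 < k by omega, dite_true]
    exact hUT (Finset.orderEmbOfFin_mem U hU _)

lemma sameBlock_iff_part_eq_s9 {n : ℕ} (π : Finpartition (Idx n)) {i j : ℕ} (hi : i ∈ Idx n)
    (hj : j ∈ Idx n) : SameBlock π i j ↔ π.part i = π.part j := by
  constructor
  · rintro ⟨B, hB, hiB, hjB⟩
    rw [π.part_eq_of_mem hB hiB, π.part_eq_of_mem hB hjB]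
  · intro h
    exact ⟨π.part i, π.part_mem.2 hi, π.mem_part hi, h ▸ π.mem_part hj⟩

lemma card_Idx (n : ℕ) : (Idx n).card = n := by simp [Idx]

lemma contains_singletons_iff {k n : ℕ} (τ : Finpartition (Idx k))
    (hτ : τ.parts = (Idx k).image (fun x => {x})) (σ : Finpartition (Idx n)) :
    Contains τ σ ↔ k ≤ σ.parts.card := by
  have hsame : ∀ i ∈ Idx k, ∀ j ∈ Idx k, (SameBlock τ i j ↔ i = j) := by
    intro i hi j hj
    simp only [SameBlock, hτ, Finset.mem_image, exists_exists_and_eq_and, Finset.mem_singleton]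
    constructor
    · rintro ⟨x, -, rfl, rfl⟩; rfl
    · rintro rfl; exact ⟨i, hi, rfl, rfl⟩
  constructor
  · rintro ⟨f, -, hfn, hf⟩
    rw [← card_Idx k]
    refine Finset.card_le_card_of_injOn (fun i => σ.part (f i))
      (fun i hi => σ.part_mem.2 (hfn i hi)) ?_
    intro i hi j hj hij
    exact (hsame i hi j hj).1 ((hf i hi j hj).2
      ((sameBlock_iff_part_eq_s9 σ (hfn i hi) (hfn j hj)).2 hij))
  · intro h
    have hrep : ∀ B : Finset ℕ, ∃ x, B ∈ σ.parts → x ∈ B := by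
      intro B
      by_cases hB : B ∈ σ.parts
      · obtain ⟨x, hx⟩ := σ.nonempty_of_mem_parts hB
        exact ⟨x, fun _ => hx⟩
      · exact ⟨0, fun h' => absurd h' hB⟩
    choose r hr using hrep
    have hinj : Set.InjOn r σ.parts := fun B hB C hC hBC =>
      σ.eq_of_mem_parts hB hC (hr B hB) (hBC ▸ hr C hC)
    obtain ⟨f, hf, hfT⟩ := exists_strictMonoOn_of_le_card (k := k) (T := σ.parts.image r)
      (by rwa [Finset.card_image_of_injOn hinj])
    refine ⟨f, hf, ?_, ?_⟩
    · intro i hi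
      obtain ⟨B, hB, hBi⟩ := Finset.mem_image.1 (hfT i hi)
      exact hBi ▸ σ.le hB (hr B hB)
    · intro i hi j hj
      rw [hsame i hi j hj]
      obtain ⟨B, hB, hBi⟩ := Finset.mem_image.1 (hfT i hi)
      obtain ⟨C, hC, hCj⟩ := Finset.mem_image.1 (hfT j hj)
      constructor
      · rintro rfl
        exact ⟨B, hB, hBi ▸ hr B hB, hBi ▸ hr B hB⟩
      · rintro ⟨D, hD, hiD, hjD⟩
        have hBD := σ.eq_of_mem_parts hB hD (hr B hB) (hBi ▸ hiD)
        have hCD := σ.eq_of_mem_parts hC hD (hr C hC) (hCj ▸ hjD)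
        apply hf.injOn hi hj
        rw [← hBi, ← hCj, hBD, hCD]

lemma contains_single_block_iff {k n : ℕ} (hk : 0 < k) (τ : Finpartition (Idx k))
    (hτ : τ.parts = {Idx k}) (σ : Finpartition (Idx n)) :
    Contains τ σ ↔ ∃ B ∈ σ.parts, k ≤ B.card := by
  have hsame : ∀ i ∈ Idx k, ∀ j ∈ Idx k, SameBlock τ i j :=
    fun i hi j hj => ⟨Idx k, by simp [hτ], hi, hj⟩
  have hone : 1 ∈ Idx k := by simp only [Idx, Finset.mem_Icc]; omega
  constructor
  · rintro ⟨f, hfm, hfn, hf⟩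
    refine ⟨σ.part (f 1), σ.part_mem.2 (hfn 1 hone), ?_⟩
    conv_lhs => rw [← card_Idx k]
    refine Finset.card_le_card_of_injOn f (fun i hi => ?_) hfm.injOn
    have := (sameBlock_iff_part_eq_s9 σ (hfn 1 hone) (hfn i hi)).1
      ((hf 1 hone i hi).1 (hsame 1 hone i hi))
    rw [this]
    exact σ.mem_part (hfn i hi)
  · rintro ⟨B, hB, hBk⟩
    obtain ⟨f, hf, hfB⟩ := exists_strictMonoOn_of_le_card hBk
    exact ⟨f, hf, fun i hi => σ.le hB (hfB i hi), fun i hi j hj =>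
      ⟨fun _ => ⟨B, hB, hfB i hi, hfB j hj⟩, fun _ => hsame i hi j hj⟩⟩

/-- `|Π_n(σ_k)| ≤ |Π_n(β_k)|` for all `k ≥ 2`, `n ≥ 1`, with strict inequality
whenever `n > k > 2`. -/
theorem avoidCount_singletons_le_beta (k : ℕ) (hk : 2 ≤ k)
    (σk βk : Finpartition (Idx k))
    (hσk : σk.parts = (Idx k).image (fun x => {x}))
    (hβk : βk.parts = {Idx k}) :
    (∀ n : ℕ, 1 ≤ n → avoidCount n σk ≤ avoidCount n βk) ∧
    (∀ n : ℕ, 2 < k → k < n → avoidCount n σk < avoidCount n βk) := by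
  obtain ⟨m, rfl⟩ : ∃ m, k = m + 1 := ⟨k - 1, by omega⟩
  have hσ : ∀ {n : ℕ} (σ : Finpartition (Idx n)), Avoids σ σk ↔ σ.parts.card ≤ m := by
    intro n σ
    rw [Avoids, contains_singletons_iff σk hσk]
    omega
  have hβ : ∀ {n : ℕ} (σ : Finpartition (Idx n)), Avoids σ βk ↔ ∀ B ∈ σ.parts, B.card ≤ m := by
    intro n σ
    rw [Avoids, contains_single_block_iff m.succ_pos βk hβk]
    push Not
    simp only [Nat.lt_succ_iff]
  have hinj : ∀ (n : ℕ) (φ : Finset (Finset ℕ) → Finset (Finset ℕ)),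
      IsBlockInjection (Idx n) m φ →
      ∃ Φ : {σ : Finpartition (Idx n) // Avoids σ σk} →
          {σ : Finpartition (Idx n) // Avoids σ βk},
        Function.Injective Φ ∧ ∀ σ, (Φ σ).1.parts = φ σ.1.parts := by
    intro n φ hφ
    refine ⟨fun σ => ⟨(hφ.isBlocks _ (.of_finpartition σ.1) ((hσ _).1 σ.2)).toFinpartition,
      (hβ _).2 (hφ.card_le _ (.of_finpartition σ.1) ((hσ _).1 σ.2))⟩, ?_, fun _ => rfl⟩
    intro σ τ h
    apply Subtype.ext
    apply Finpartition.ext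
    exact hφ.inj _ _ (.of_finpartition σ.1) ((hσ _).1 σ.2) (.of_finpartition τ.1)
      ((hσ _).1 τ.2) (congrArg (fun ρ => ρ.1.parts) h)
  constructor
  · intro n _
    obtain ⟨φ, hφ⟩ := exists_isBlockInjection m (Idx n)
    obtain ⟨Φ, hΦ, -⟩ := hinj n φ hφ
    exact Nat.card_le_card_of_injective Φ hΦ
  · intro n hk2 hkn
    obtain ⟨φ, hφ, G, hG, hGm, hne⟩ := exists_isBlockInjection_not_surj (m := m)
      (by omega) (s := Idx n) (by rw [card_Idx]; omega)
    obtain ⟨Φ, hΦ, hparts⟩ := hinj n φ hφ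
    have := Fintype.ofFinite {σ : Finpartition (Idx n) // Avoids σ σk}
    have := Fintype.ofFinite {σ : Finpartition (Idx n) // Avoids σ βk}
    rw [avoidCount, avoidCount, Nat.card_eq_fintype_card, Nat.card_eq_fintype_card]
    refine Fintype.card_lt_of_injective_of_notMem Φ hΦ
      (b := ⟨hG.toFinpartition, (hβ _).2 hGm⟩) ?_
    rintro ⟨σ, h⟩
    refine hne σ.1.parts (.of_finpartition σ.1) ((hσ _).1 σ.2) ?_
    rw [← hparts, h]
    rfl
end
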